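/- Concentration of the number of edges in the inverted process. Let H be a 2-balanced graph and set m = ⌈n^{2−1/m_2(H)}(log n)²⌉. Let e(G_{n,m}(H)) denote the number of edges of the graph G_{n,m}(H) produced by traversing the first m edges of a uniformly random ordering of the edges of the complete graph K_n, adding each traversed edge if and only if it does not complete a copy of H together with the previously traversed edges. Then for every c > 0 there exists n_0 = n_0(c,H) such that for all n ≥ n_0, P(|e(G_{n,m}(H)) − E e(G_{n,m}(H))| ≥ √m·(log n)^{3e_H}) ≤ n^{−c}. -/

import Mathlib

open scoped ENNReal

noncomputable def prOf {α : Type*} (μ : PMF α) (E : Set α) : ℝ≥0∞ :=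
  ∑' x : E, μ x

/-- `d_2(H) = (e_H - 1)/(v_H - 2)`. -/
noncomputable def d2 {β : Type*} [Fintype β] (H : SimpleGraph β) : ℝ :=
  ((H.edgeSet.ncard : ℝ) - 1) / ((Fintype.card β : ℝ) - 2)

/-- `H` is 2-balanced: `e_H ≥ 2` and every proper subgraph `G ⊊ H` with at least 3
vertices satisfies `(e_G - 1)/(v_G - 2) ≤ d_2(H)`. -/
def TwoBalanced {β : Type*} [Fintype β] (H : SimpleGraph β) : Prop :=
  2 ≤ H.edgeSet.ncard ∧
    ∀ G : H.Subgraph, G ≠ ⊤ → 3 ≤ G.verts.ncard →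
      ((G.edgeSet.ncard : ℝ) - 1) / ((G.verts.ncard : ℝ) - 2) ≤ d2 H

/-- `m_2(H)`: the maximum of `d_2(G)` over all subgraphs `G ⊆ H` with at least one edge,
where a subgraph with exactly one edge (a copy of `K_2`) has `d_2 = 1/2`. -/
noncomputable def m2 {β : Type*} [Fintype β] (H : SimpleGraph β) : ℝ :=
  sSup {x : ℝ | ∃ G : H.Subgraph, 1 ≤ G.edgeSet.ncard ∧
    x = if G.edgeSet.ncard = 1 then 1 / 2
        else ((G.edgeSet.ncard : ℝ) - 1) / ((G.verts.ncard : ℝ) - 2)}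

/-- The edge set `E` contains a copy of `H` using the edge `e`. -/
def copyAt {β V : Type*} (H : SimpleGraph β) (E : Set (Sym2 V)) (e : Sym2 V) : Prop :=
  ∃ φ : β ↪ V, (∀ a b, H.Adj a b → s(φ a, φ b) ∈ E) ∧ ∃ a b, H.Adj a b ∧ e = s(φ a, φ b)

/-- The edges of the complete graph `K_n` on `Fin n`. -/
abbrev EdgeType (n : ℕ) := {e : Sym2 (Fin n) // ¬ e.IsDiag}

/-- A uniformly random ordering of the edges of `K_n` is a uniformly random bijection
from the edges to `Fin (number of edges)`. -/
abbrev EdgeOrder (n : ℕ) := EdgeType n ≃ Fin (Fintype.card (EdgeType n))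

/-- The uniform distribution on orderings of the edges of `K_n`. -/
noncomputable def ordPMF (n : ℕ) : PMF (EdgeOrder n) :=
  haveI : Nonempty (EdgeOrder n) := ⟨Fintype.equivFin _⟩
  PMF.uniformOfFintype _

/-- The edge set of `G_{n,m}(H)`: traversing the first `m` edges of the ordering `ord`,
each traversed edge is added iff it does not complete a copy of `H` together with the
previously traversed edges. -/
def keptEdges {β : Type*} (H : SimpleGraph β) (n m : ℕ) (ord : EdgeOrder n) :
    Set (Sym2 (Fin n)) :=
  {e₀ | ∃ e : EdgeType n, e₀ = e.1 ∧ (ord e : ℕ) < m ∧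
    ¬ copyAt H {f | ∃ g : EdgeType n, f = g.1 ∧ ord g ≤ ord e} e.1}

/-- The expected number of edges of `G_{n,m}(H)`. -/
noncomputable def expKept {β : Type*} (H : SimpleGraph β) (n m : ℕ) : ℝ :=
  ∑' ord : EdgeOrder n, ((ordPMF n) ord).toReal * ((keptEdges H n m ord).ncard : ℝ)

def DepFirst {α : Type*} {N : ℕ} (i : ℕ) (g : (α ≃ Fin N) → ℝ) : Prop :=
  ∀ ω ω' : α ≃ Fin N, (∀ j : Fin N, (j : ℕ) < i → ω.symm j = ω'.symm j) → g ω = g ω'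

def LipSwap {α : Type*} [DecidableEq α] {N : ℕ} (c : ℝ) (g : (α ≃ Fin N) → ℝ) : Prop :=
  ∀ (a b : α) (ω : α ≃ Fin N), |g ((Equiv.swap a b).trans ω) - g ω| ≤ c

open BigOperators in
noncomputable def avgAt {α : Type*} {N : ℕ} (i : Fin N) (g : (α ≃ Fin N) → ℝ)
    (ω : α ≃ Fin N) : ℝ :=
  𝔼 j ∈ Finset.Ici i, g (ω.trans (Equiv.swap i j))

section Azuma
open BigOperators
set_option linter.unusedSectionVars false

variable {α : Type*} [Fintype α] [DecidableEq α] {N : ℕ}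

lemma expect_trans (σ : Equiv.Perm (Fin N)) (g : (α ≃ Fin N) → ℝ) :
    𝔼 ω : α ≃ Fin N, g (ω.trans σ) = 𝔼 ω : α ≃ Fin N, g ω := by
  exact Fintype.expect_equiv (Equiv.equivCongr (Equiv.refl α) σ) _ _ (fun ω => rfl)

lemma expect_avgAt (i : Fin N) (g : (α ≃ Fin N) → ℝ) :
    𝔼 ω, avgAt i g ω = 𝔼 ω, g ω := by
  unfold avgAt
  rw [Finset.expect_comm]
  simp_rw [expect_trans]
  rw [Finset.expect_const ⟨i, by simp⟩]

lemma dep_avgAt (i : Fin N) (g : (α ≃ Fin N) → ℝ) (hg : DepFirst (i + 1) g) :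
    DepFirst i (avgAt i g) := by
  intro ω ω' h
  unfold avgAt
  have key : ∀ ω ω' : α ≃ Fin N, (∀ j : Fin N, (j : ℕ) < i → ω.symm j = ω'.symm j) →
      ∀ j, i ≤ j → i ≤ ω' (ω.symm j) := by
    intro ω ω' h j hj
    by_contra hlt
    push Not at hlt
    have := h (ω' (ω.symm j)) hlt
    simp only [Equiv.symm_apply_apply] at this
    have h2 := ω.symm.injective this
    rw [h2] at hlt
    exact absurd hj (not_le.mpr hlt)
  refine Finset.expect_bij' (fun j _ => ω' (ω.symm j)) (fun j _ => ω (ω'.symm j)) ?_ ?_ ?_ ?_ ?_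
  · intro j hj
    simp only [Finset.mem_Ici] at hj ⊢
    exact key ω ω' h j hj
  · intro j hj
    simp only [Finset.mem_Ici] at hj ⊢
    exact key ω' ω (fun j hj => (h j hj).symm) j hj
  · intro j hj; simp
  · intro j hj; simp
  · intro j hj
    simp only [Finset.mem_Ici] at hj
    apply hg
    intro l hl
    simp only [Equiv.symm_trans_apply, Equiv.symm_swap]
    rcases Nat.lt_succ_iff_lt_or_eq.mp hl with hl | hl
    · have hli : l ≠ i := by rintro rfl; exact lt_irrefl _ hl
      have hlj : l ≠ j := by rintro rfl; exact absurd hj (not_le.mpr hl)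
      have hlj' : l ≠ ω' (ω.symm j) := by
        rintro rfl
        exact absurd (key ω ω' h j hj) (not_le.mpr hl)
      rw [Equiv.swap_apply_of_ne_of_ne hli hlj, Equiv.swap_apply_of_ne_of_ne hli hlj']
      exact h l hl
    · have : l = i := Fin.ext hl
      subst this
      simp

lemma lip_avgAt (i : Fin N) (g : (α ≃ Fin N) → ℝ) (c : ℝ) (hg : LipSwap c g) :
    LipSwap c (avgAt i g) := by
  intro a b ω
  unfold avgAt
  rw [← Finset.expect_sub_distrib]
  refine (Finset.abs_expect_le _ _).trans ?_
  refine Finset.expect_le ⟨i, by simp⟩ ?_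
  intro j _
  exact hg a b (ω.trans (Equiv.swap i j))

lemma exp_avg_le {κ : Type*} (s : Finset κ) (x : κ → ℝ) (a : ℝ) (ha : 0 < a)
    (hx : ∀ j ∈ s, |x j| ≤ a) (h0 : 𝔼 j ∈ s, x j = 0) (hs : s.Nonempty) :
    𝔼 j ∈ s, Real.exp (x j) ≤ Real.exp (a ^ 2 / 2) := by
  have h1 : ∀ j ∈ s, Real.exp (x j) ≤ Real.cosh a + x j * (Real.sinh a / a) := by
    intro j hj
    have hj' := abs_le.mp (hx j hj)
    have hce := convexOn_exp.2
    have := @hce a (Set.mem_univ a) (-a) (Set.mem_univ (-a))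
      ((a + x j) / (2 * a)) ((a - x j) / (2 * a))
      (by apply div_nonneg <;> linarith) (by apply div_nonneg <;> linarith)
      (by field_simp; ring)
    have e1 : ((a + x j) / (2 * a)) • a + ((a - x j) / (2 * a)) • (-a) = x j := by
      simp only [smul_eq_mul]; field_simp; ring
    rw [e1] at this
    refine this.trans (le_of_eq ?_)
    rw [Real.cosh_eq, Real.sinh_eq]
    simp only [smul_eq_mul]; field_simp; ring
  refine (Finset.expect_le_expect h1).trans ?_
  rw [Finset.expect_add_distrib, Finset.expect_const hs, ← Finset.expect_mul, h0]
  simp only [zero_mul, add_zero]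
  exact Real.cosh_le_exp_half_sq a

lemma mgf_bound (c : ℝ) (hc : 0 < c) (t : ℝ) (ht : t ≠ 0) :
    ∀ (i : ℕ), i ≤ N → ∀ g : (α ≃ Fin N) → ℝ, DepFirst i g → LipSwap c g →
    𝔼 ω, Real.exp (t * (g ω - 𝔼 ω', g ω')) ≤ Real.exp (i * ((2 * c * |t|) ^ 2 / 2)) := by
  intro i
  induction i with
  | zero =>
    intro _ g hg _
    rcases isEmpty_or_nonempty (α ≃ Fin N) with hE | ⟨⟨ω₀⟩⟩
    · simp
    · have : ∀ ω, g ω = g ω₀ := fun ω => hg _ _ (by intro j hj; omega)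
      simp only [this]
      have : Nonempty (α ≃ Fin N) := ⟨ω₀⟩
      simp [Finset.expect_const]
  | succ i ih =>
    intro hi g hd hl
    set p : Fin N := ⟨i, hi⟩ with hp
    have hd' : DepFirst i (avgAt p g) := dep_avgAt p g hd
    have ihg := ih (by omega) (avgAt p g) hd' (lip_avgAt p g c hl)
    rw [expect_avgAt] at ihg
    set μ := 𝔼 ω', g ω' with hμ
    rw [← expect_avgAt p]
    have step : ∀ ω : α ≃ Fin N, avgAt p (fun ω => Real.exp (t * (g ω - μ))) ω ≤
        Real.exp ((2 * c * |t|) ^ 2 / 2) * Real.exp (t * (avgAt p g ω - μ)) := by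
      intro ω
      have hne : (Finset.Ici p).Nonempty := ⟨p, by simp⟩
      have hclose : ∀ j, |g (ω.trans (Equiv.swap p j)) - g ω| ≤ c := by
        intro j
        have h := hl (ω.symm p) (ω.symm j) ω
        have : (Equiv.swap (ω.symm p) (ω.symm j)).trans ω = ω.trans (Equiv.swap p j) := by
          ext x
          simp only [Equiv.trans_apply]
          rw [← ω.injective.swap_apply]
          simp
        rwa [this] at h
      have havg : |avgAt p g ω - g ω| ≤ c := by
        have : avgAt p g ω - g ω
            = 𝔼 j ∈ Finset.Ici p, (g (ω.trans (Equiv.swap p j)) - g ω) := by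
          rw [Finset.expect_sub_distrib, Finset.expect_const hne]; rfl
        rw [this]
        exact (Finset.abs_expect_le _ _).trans (Finset.expect_le hne (fun j _ => hclose j))
      have hb := exp_avg_le (Finset.Ici p)
        (fun j => t * (g (ω.trans (Equiv.swap p j)) - avgAt p g ω)) (2 * c * |t|)
        (by positivity)
        (by
          intro j _
          rw [abs_mul, mul_comm]
          apply mul_le_mul_of_nonneg_right _ (abs_nonneg t)
          have h1 := abs_le.mp (hclose j)
          have h2 := abs_le.mp havg
          rw [abs_le]; constructor <;> linarith [h1.1, h1.2, h2.1, h2.2])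
        (by
          rw [← Finset.mul_expect, Finset.expect_sub_distrib, Finset.expect_const hne]
          simp [avgAt])
        hne
      have : avgAt p (fun ω => Real.exp (t * (g ω - μ))) ω =
          (𝔼 j ∈ Finset.Ici p, Real.exp (t * (g (ω.trans (Equiv.swap p j)) - avgAt p g ω))) *
            Real.exp (t * (avgAt p g ω - μ)) := by
        rw [Finset.expect_mul]
        unfold avgAt
        apply Finset.expect_congr rfl
        intro j _
        rw [← Real.exp_add]
        ring_nf
      rw [this]
      exact mul_le_mul_of_nonneg_right hb (Real.exp_nonneg _)
    refine (Finset.expect_le_expect (fun ω _ => step ω)).trans ?_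
    rw [← Finset.mul_expect]
    refine (mul_le_mul_of_nonneg_left ihg (Real.exp_nonneg _)).trans (le_of_eq ?_)
    rw [← Real.exp_add]
    congr 1
    push_cast; ring

/-- one-sided Chernoff -/
lemma azuma_one (c : ℝ) (hc : 0 < c) (i m : ℕ) (hi : i ≤ N) (him : i ≤ m) (hm : 0 < m)
    (g : (α ≃ Fin N) → ℝ) (hd : DepFirst i g) (hl : LipSwap c g) (s : ℝ) (hs : 0 < s)
    (t : ℝ) (ht : |t| = s / (m * (2 * c) ^ 2)) :
    𝔼 ω, (if |t| * s ≤ t * (g ω - 𝔼 ω', g ω') then (1 : ℝ) else 0) ≤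
      Real.exp (- (s ^ 2 / (2 * m * (2 * c) ^ 2))) := by
  have hm' : (0 : ℝ) < m := by exact_mod_cast hm
  have htpos : 0 < |t| := by rw [ht]; positivity
  have hb := mgf_bound (α := α) c hc t (abs_pos.mp htpos) i hi g hd hl
  have h1 : ∀ ω : α ≃ Fin N, (if |t| * s ≤ t * (g ω - 𝔼 ω', g ω') then (1 : ℝ) else 0) ≤
      Real.exp (-(|t| * s)) * Real.exp (t * (g ω - 𝔼 ω', g ω')) := by
    intro ω
    split_ifs with h
    · rw [← Real.exp_add]
      apply Real.one_le_exp; linarith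
    · positivity
  refine (Finset.expect_le_expect (fun ω _ => h1 ω)).trans ?_
  rw [← Finset.mul_expect]
  refine (mul_le_mul_of_nonneg_left hb (Real.exp_nonneg _)).trans ?_
  rw [← Real.exp_add]
  apply Real.exp_le_exp.mpr
  have : (i : ℝ) * ((2 * c * |t|) ^ 2 / 2) ≤ m * ((2 * c * |t|) ^ 2 / 2) := by
    apply mul_le_mul_of_nonneg_right (by exact_mod_cast him) (by positivity)
  have e : -(|t| * s) + m * ((2 * c * |t|) ^ 2 / 2) = - (s ^ 2 / (2 * m * (2 * c) ^ 2)) := by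
    rw [ht]; field_simp; ring_nf
  linarith

lemma azuma (c : ℝ) (hc : 0 < c) (i m : ℕ) (hi : i ≤ N) (him : i ≤ m) (hm : 0 < m)
    (g : (α ≃ Fin N) → ℝ) (hd : DepFirst i g) (hl : LipSwap c g) (s : ℝ) (hs : 0 < s) :
    𝔼 ω, (if s ≤ |g ω - 𝔼 ω', g ω'| then (1 : ℝ) else 0) ≤
      2 * Real.exp (- (s ^ 2 / (2 * m * (2 * c) ^ 2))) := by
  have hm' : (0 : ℝ) < m := by exact_mod_cast hm
  set t := s / (m * (2 * c) ^ 2) with ht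
  have htpos : 0 < t := by positivity
  have h1 := azuma_one c hc i m hi him hm g hd hl s hs t (abs_of_pos htpos)
  have h2 := azuma_one c hc i m hi him hm g hd hl s hs (-t) (by rw [abs_neg]; exact abs_of_pos htpos)
  rw [abs_neg] at h2
  rw [abs_of_pos htpos] at h1 h2
  have : ∀ ω : α ≃ Fin N, (if s ≤ |g ω - 𝔼 ω', g ω'| then (1 : ℝ) else 0) ≤
      (if t * s ≤ t * (g ω - 𝔼 ω', g ω') then (1 : ℝ) else 0) +
      (if t * s ≤ -t * (g ω - 𝔼 ω', g ω') then (1 : ℝ) else 0) := by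
    intro ω
    by_cases h : s ≤ |g ω - 𝔼 ω', g ω'|
    · rw [if_pos h]
      rcases le_abs.mp h with h | h
      · rw [if_pos (mul_le_mul_of_nonneg_left h htpos.le)]
        split_ifs <;> norm_num
      · rw [if_pos (c := t * s ≤ -t * (g ω - 𝔼 ω', g ω'))
          (by have := mul_le_mul_of_nonneg_left h htpos.le; linarith)]
        split_ifs <;> norm_num
    · rw [if_neg h]
      split_ifs <;> norm_num
  refine (Finset.expect_le_expect (fun ω _ => this ω)).trans ?_
  rw [Finset.expect_add_distrib]
  linarith

end Azuma

section Moments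
open BigOperators
open scoped Classical
set_option linter.unusedSectionVars false

variable {α : Type*} [Fintype α] {N : ℕ} {ι : Type*} [Fintype ι]

/-- all elements of `U` are among the first `m` -/
def InFirst (m : ℕ) (ω : α ≃ Fin N) (U : Finset α) : Prop := ∀ e ∈ U, (ω e : ℕ) < m

lemma expect_swap (a b : α) (g : (α ≃ Fin N) → ℝ) :
    𝔼 ω : α ≃ Fin N, g ((Equiv.swap a b).trans ω) = 𝔼 ω : α ≃ Fin N, g ω := by
  exact Fintype.expect_equiv (Equiv.equivCongr (Equiv.swap a b) (Equiv.refl _)) _ _ (fun ω => by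
    congr 1)

lemma inFirst_swap (m : ℕ) (ω : α ≃ Fin N) (U : Finset α) (a b : α) (ha : a ∉ U) (hb : b ∉ U) :
    InFirst m ((Equiv.swap a b).trans ω) (insert a U) ↔ InFirst m ω (insert b U) := by
  unfold InFirst
  simp only [Finset.forall_mem_insert, Equiv.trans_apply, Equiv.swap_apply_left]
  apply and_congr Iff.rfl
  apply forall₂_congr
  intro e he
  rw [Equiv.swap_apply_of_ne_of_ne]
  · rintro rfl; exact ha he
  · rintro rfl; exact hb he

lemma card_first (m : ℕ) (ω : α ≃ Fin N) :
    (Finset.univ.filter fun b : α => (ω b : ℕ) < m).card ≤ m := by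
  have : (Finset.univ.filter fun b : α => (ω b : ℕ) < m).card ≤ (Finset.range m).card := by
    apply Finset.card_le_card_of_injOn (fun b => (ω b : ℕ))
    · intro b hb; simpa using hb
    · intro b _ b' _ h; exact ω.injective (Fin.ext h)
  simpa using this

lemma prob_step (hN : Fintype.card α = N) (m : ℕ) (U : Finset α) (a : α) (ha : a ∉ U) :
    𝔼 ω : α ≃ Fin N, (if InFirst m ω (insert a U) then (1 : ℝ) else 0) ≤
      ((m : ℝ) / N) * 𝔼 ω : α ≃ Fin N, (if InFirst m ω U then (1 : ℝ) else 0) := by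
  set P := 𝔼 ω : α ≃ Fin N, (if InFirst m ω (insert a U) then (1 : ℝ) else 0) with hP
  set Q := 𝔼 ω : α ≃ Fin N, (if InFirst m ω U then (1 : ℝ) else 0) with hQ
  have hQ0 : 0 ≤ Q := Finset.expect_nonneg (fun ω _ => by split_ifs <;> norm_num)
  have hP0 : 0 ≤ P := Finset.expect_nonneg (fun ω _ => by split_ifs <;> norm_num)
  have hsym : ∀ b ∈ Uᶜ, 𝔼 ω : α ≃ Fin N, (if InFirst m ω (insert b U) then (1 : ℝ) else 0) = P := by
    intro b hb
    rw [Finset.mem_compl] at hb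
    rw [hP, ← expect_swap a b (fun ω => if InFirst m ω (insert a U) then (1 : ℝ) else 0)]
    apply Finset.expect_congr rfl
    intro ω _
    simp only [inFirst_swap m ω U a b ha hb]
  have huN : U.card + 1 ≤ N := by
    rw [← hN, ← Finset.card_insert_of_notMem ha]; exact Finset.card_le_univ _
  have h1 : ((N : ℝ) - U.card) * P =
      𝔼 ω : α ≃ Fin N, ∑ b ∈ Uᶜ, (if InFirst m ω (insert b U) then (1 : ℝ) else 0) := by
    rw [Finset.expect_sum_comm, Finset.sum_congr rfl hsym]
    rw [Finset.sum_const, Finset.card_compl, hN, nsmul_eq_mul, Nat.cast_sub (by omega)]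
  have h2 : ∀ ω : α ≃ Fin N, ∑ b ∈ Uᶜ, (if InFirst m ω (insert b U) then (1 : ℝ) else 0) ≤
      (((min m N : ℕ) : ℝ) - U.card) * (if InFirst m ω U then (1 : ℝ) else 0) := by
    intro ω
    by_cases hU : InFirst m ω U
    · rw [if_pos hU, mul_one]
      rw [← Finset.sum_filter, Finset.sum_const, nsmul_eq_mul, mul_one]
      have hsub : (Finset.filter (fun b => InFirst m ω (insert b U)) Uᶜ) ∪ U ⊆
          (Finset.univ.filter fun b : α => (ω b : ℕ) < m) := by
        intro b hb
        simp only [Finset.mem_union, Finset.mem_filter, Finset.mem_univ, true_and] at hb ⊢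
        rcases hb with ⟨_, hb⟩ | hb
        · exact hb b (Finset.mem_insert_self _ _)
        · exact hU b hb
      have hdisj : Disjoint (Finset.filter (fun b => InFirst m ω (insert b U)) Uᶜ) U := by
        rw [Finset.disjoint_left]
        intro b hb hb'
        simp only [Finset.mem_filter, Finset.mem_compl] at hb
        exact hb.1 hb'
      have hc := Finset.card_le_card hsub
      rw [Finset.card_union_of_disjoint hdisj] at hc
      have hc1 := card_first m ω
      have hc2 : (Finset.univ.filter fun b : α => (ω b : ℕ) < m).card ≤ N := by
        exact (Finset.card_le_univ _).trans hN.le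
      have : (Finset.filter (fun b => InFirst m ω (insert b U)) Uᶜ).card + U.card ≤ min m N := by
        omega
      have h3 : (((Finset.filter (fun b => InFirst m ω (insert b U)) Uᶜ).card : ℕ) : ℝ) + U.card ≤
        ((min m N : ℕ) : ℝ) := by exact_mod_cast this
      linarith
    · rw [if_neg hU, mul_zero]
      apply le_of_eq
      apply Finset.sum_eq_zero
      intro b _
      rw [if_neg]
      intro h; exact hU (fun e he => h e (Finset.mem_insert_of_mem he))
  have h3 : ((N : ℝ) - U.card) * P ≤ (((min m N : ℕ) : ℝ) - U.card) * Q := by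
    rw [h1, hQ, Finset.mul_expect]
    exact Finset.expect_le_expect (fun ω _ => h2 ω)
  have huN' : (U.card : ℝ) + 1 ≤ N := by exact_mod_cast huN
  have hu0 : (0 : ℝ) ≤ U.card := Nat.cast_nonneg _
  have hM1 : ((min m N : ℕ) : ℝ) ≤ N := by exact_mod_cast min_le_right _ _
  have hM2 : ((min m N : ℕ) : ℝ) ≤ m := by exact_mod_cast min_le_left _ _
  set M := ((min m N : ℕ) : ℝ)
  have hNpos : (0 : ℝ) < N := by linarith
  rw [div_mul_eq_mul_div, le_div_iff₀ hNpos]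
  have h4 : (N - U.card : ℝ) * (P * N) ≤ (N - U.card : ℝ) * (M * Q) := by
    have : (M - U.card) * N ≤ M * (N - U.card) := by nlinarith
    calc (N - U.card : ℝ) * (P * N) = ((N - U.card : ℝ) * P) * N := by ring
      _ ≤ ((M - U.card) * Q) * N := mul_le_mul_of_nonneg_right h3 hNpos.le
      _ = ((M - U.card) * N) * Q := by ring
      _ ≤ (M * (N - U.card)) * Q := mul_le_mul_of_nonneg_right this hQ0
      _ = _ := by ring
  have h5 := le_of_mul_le_mul_left h4 (by linarith)
  exact h5.trans (mul_le_mul_of_nonneg_right hM2 hQ0)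

lemma prob_subset (hN : Fintype.card α = N) (m : ℕ) (U : Finset α) :
    𝔼 ω : α ≃ Fin N, (if InFirst m ω U then (1 : ℝ) else 0) ≤ ((m : ℝ) / N) ^ U.card := by
  induction U using Finset.induction_on with
  | empty =>
    simp only [Finset.card_empty, pow_zero]
    have hne : Nonempty (α ≃ Fin N) := ⟨Fintype.equivFinOfCardEq hN⟩
    refine Finset.expect_le Finset.univ_nonempty ?_
    intro ω _; split_ifs <;> norm_num
  | insert a U ha ih =>
    rw [Finset.card_insert_of_notMem ha, pow_succ, mul_comm]
    exact (prob_step hN m U a ha).trans (mul_le_mul_of_nonneg_left ih (by positivity))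

/-- number of members of the family through `f` contained in the first `m` elements -/
noncomputable def Xcnt (S : ι → Finset α) (m : ℕ) (f : α) (ω : α ≃ Fin N) : ℕ :=
  (Finset.univ.filter fun i => f ∈ S i ∧ InFirst m ω (S i)).card

lemma moment_bound (hN : Fintype.card α = N) (S : ι → Finset α) (r : ℕ)
    (hS : ∀ i, (S i).card = r) (m : ℕ) (f : α) (M : ℕ) (B : ℝ) (hB0 : 0 ≤ B)
    (hB : ∀ U : Finset α, f ∈ U → U.card ≤ M →
      ∑ i ∈ Finset.univ.filter (fun i => f ∈ S i), ((m : ℝ) / N) ^ (S i \ U).card ≤ B) :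
    ∀ (k : ℕ) (U : Finset α), f ∈ U → U.card + k * r ≤ M →
      𝔼 ω : α ≃ Fin N, (if InFirst m ω U then (1 : ℝ) else 0) * (Xcnt S m f ω : ℝ) ^ k ≤
        ((m : ℝ) / N) ^ U.card * B ^ k := by
  intro k
  induction k with
  | zero =>
    intro U _ _
    simpa using prob_subset hN m U
  | succ k ih =>
    intro U hf hU
    have e1 : ∀ ω : α ≃ Fin N,
        (if InFirst m ω U then (1 : ℝ) else 0) * (Xcnt S m f ω : ℝ) ^ (k + 1) =
        ∑ i ∈ Finset.univ.filter (fun i => f ∈ S i),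
          (if InFirst m ω (U ∪ S i) then (1 : ℝ) else 0) * (Xcnt S m f ω : ℝ) ^ k := by
      intro ω
      have hX : (Xcnt S m f ω : ℝ) = ∑ i ∈ Finset.univ.filter (fun i => f ∈ S i),
          (if InFirst m ω (S i) then (1 : ℝ) else 0) := by
        unfold Xcnt
        rw [← Finset.filter_filter, Finset.sum_boole]
      rw [pow_succ]
      nth_rewrite 2 [hX]
      rw [← mul_assoc, Finset.mul_sum]
      apply Finset.sum_congr rfl
      intro i _
      have : InFirst m ω (U ∪ S i) ↔ InFirst m ω U ∧ InFirst m ω (S i) := by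
        unfold InFirst
        simp only [Finset.mem_union]
        constructor
        · intro h; exact ⟨fun e he => h e (Or.inl he), fun e he => h e (Or.inr he)⟩
        · rintro ⟨h1, h2⟩ e (he | he)
          · exact h1 e he
          · exact h2 e he
      by_cases h1 : InFirst m ω U <;> by_cases h2 : InFirst m ω (S i) <;> simp [this, h1, h2]
    simp_rw [e1]
    rw [Finset.expect_sum_comm]
    have e2 : ∀ i ∈ Finset.univ.filter (fun i => f ∈ S i),
        𝔼 ω : α ≃ Fin N, (if InFirst m ω (U ∪ S i) then (1 : ℝ) else 0) * (Xcnt S m f ω : ℝ) ^ k ≤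
        (((m : ℝ) / N) ^ U.card * B ^ k) * ((m : ℝ) / N) ^ (S i \ U).card := by
      intro i _
      have hc : (U ∪ S i).card = U.card + (S i \ U).card := by
        rw [← Finset.union_sdiff_self_eq_union, Finset.card_union_of_disjoint Finset.disjoint_sdiff]
      have hc2 : (S i \ U).card ≤ r := by
        rw [← hS i]; exact Finset.card_le_card Finset.sdiff_subset
      refine (ih (U ∪ S i) (Finset.mem_union_left _ hf) ?_).trans (le_of_eq ?_)
      · rw [hc]; rw [add_mul, one_mul] at hU; omega
      · rw [hc, pow_add]; ring
    refine (Finset.sum_le_sum e2).trans ?_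
    rw [← Finset.mul_sum]
    have := mul_le_mul_of_nonneg_left (hB U hf (by omega))
      (show (0 : ℝ) ≤ ((m : ℝ) / N) ^ U.card * B ^ k by positivity)
    refine this.trans (le_of_eq ?_)
    ring

lemma card_small_subsets (U : Finset α) (r : ℕ) :
    (U.powerset.filter (fun J => J.card ≤ r)).card ≤ (U.card + 1) ^ r := by
  induction r with
  | zero =>
    rw [pow_zero, Finset.card_le_one]
    intro a ha b hb
    simp only [Finset.mem_filter, Nat.le_zero, Finset.card_eq_zero] at ha hb
    rw [ha.2, hb.2]
  | succ r ih =>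
    have hsub : (U.powerset.filter (fun J => J.card ≤ r + 1)) ⊆
        ((U.powerset.filter (fun J => J.card ≤ r)) ×ˢ (Finset.insertNone U)).image
          (fun p => p.2.elim p.1 (fun x => insert x p.1)) := by
      intro J hJ
      simp only [Finset.mem_filter, Finset.mem_powerset] at hJ
      simp only [Finset.mem_image, Finset.mem_product, Finset.mem_filter, Finset.mem_powerset,
        Prod.exists]
      rcases J.eq_empty_or_nonempty with rfl | ⟨x, hx⟩
      · exact ⟨∅, none, ⟨⟨by simp, by simp⟩, by simp⟩, rfl⟩
      · refine ⟨J.erase x, some x, ⟨⟨(Finset.erase_subset _ _).trans hJ.1, ?_⟩, ?_⟩, ?_⟩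
        · rw [Finset.card_erase_of_mem hx]; omega
        · simpa using hJ.1 hx
        · simp [Finset.insert_erase hx]
    refine (Finset.card_le_card hsub).trans (Finset.card_image_le.trans ?_)
    rw [Finset.card_product, Finset.card_insertNone, pow_succ]
    exact Nat.mul_le_mul_right _ ih

lemma spread_bound (S : ι → Finset α) (r : ℕ) (hS : ∀ i, (S i).card = r) (q : ℝ) (hq : 0 ≤ q)
    (D : ℝ) (hD : 0 ≤ D)
    (hdeg : ∀ J : Finset α, J.Nonempty → J.card ≤ r →
      ((Finset.univ.filter fun i => J ⊆ S i).card : ℝ) * q ^ (r - J.card) ≤ D)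
    (f : α) (U : Finset α) (hf : f ∈ U) :
    ∑ i ∈ Finset.univ.filter (fun i => f ∈ S i), q ^ (S i \ U).card ≤
      ((U.card : ℝ) + 1) ^ r * D := by
  have hmaps : ∀ i ∈ Finset.univ.filter (fun i => f ∈ S i),
      S i ∩ U ∈ (U.powerset.filter (fun J => J.card ≤ r)) := by
    intro i _
    simp only [Finset.mem_filter, Finset.mem_powerset]
    exact ⟨Finset.inter_subset_right, by rw [← hS i]; exact Finset.card_le_card Finset.inter_subset_left⟩
  rw [← Finset.sum_fiberwise_of_maps_to hmaps]
  have hb : ∀ J ∈ (U.powerset.filter (fun J => J.card ≤ r)),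
      ∑ i ∈ (Finset.univ.filter (fun i => f ∈ S i)).filter (fun i => S i ∩ U = J),
        q ^ (S i \ U).card ≤ D := by
    intro J hJ
    simp only [Finset.mem_filter, Finset.mem_powerset] at hJ
    by_cases hfJ : f ∈ J
    · refine le_trans ?_ (hdeg J ⟨f, hfJ⟩ hJ.2)
      rw [← nsmul_eq_mul, ← Finset.sum_const]
      calc _ = ∑ i ∈ (Finset.univ.filter (fun i => f ∈ S i)).filter (fun i => S i ∩ U = J),
            q ^ (r - J.card) := by
            apply Finset.sum_congr rfl
            intro i hi
            simp only [Finset.mem_filter, Finset.mem_univ, true_and] at hi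
            congr 1
            rw [← hS i, ← hi.2]
            have := Finset.card_sdiff_add_card_inter (S i) U
            omega
        _ ≤ _ := by
            apply Finset.sum_le_sum_of_subset_of_nonneg
            · intro i hi
              simp only [Finset.mem_filter, Finset.mem_univ, true_and] at hi ⊢
              rw [← hi.2]; exact Finset.inter_subset_left
            · intros; positivity
    · rw [Finset.sum_eq_zero]
      · exact hD
      · intro i hi
        simp only [Finset.mem_filter, Finset.mem_univ, true_and] at hi
        exfalso; apply hfJ; rw [← hi.2]; exact Finset.mem_inter.mpr ⟨hi.1, hf⟩
  refine (Finset.sum_le_sum hb).trans ?_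
  rw [Finset.sum_const, nsmul_eq_mul]
  apply mul_le_mul_of_nonneg_right _ hD
  exact_mod_cast card_small_subsets U r

/-- tail bound for a single `f` -/
lemma tail_X (hN : Fintype.card α = N) (S : ι → Finset α) (r : ℕ)
    (hS : ∀ i, (S i).card = r) (m : ℕ) (f : α) (D : ℝ) (hD : 0 ≤ D)
    (hdeg : ∀ J : Finset α, J.Nonempty → J.card ≤ r →
      ((Finset.univ.filter fun i => J ⊆ S i).card : ℝ) * ((m : ℝ) / N) ^ (r - J.card) ≤ D)
    (k : ℕ) (hk : 0 < k) (C : ℝ) (hC : 0 < C) :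
    𝔼 ω : α ≃ Fin N, (if C < (Xcnt S m f ω : ℝ) then (1 : ℝ) else 0) ≤
      ((m : ℝ) / N) * (((k * r + 2 : ℝ) ^ r * D) / C) ^ k := by
  have hmb := moment_bound hN S r hS m f (1 + k * r) ((k * r + 2 : ℝ) ^ r * D) (by positivity)
    (by
      intro U hf hU
      refine (spread_bound S r hS ((m : ℝ) / N) (by positivity) D hD hdeg f U hf).trans ?_
      apply mul_le_mul_of_nonneg_right _ hD
      apply pow_le_pow_left₀ (by positivity)
      have : (U.card : ℝ) ≤ 1 + k * r := by exact_mod_cast hU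
      linarith) k {f} (by simp) (by simp)
  have h1 : ∀ ω : α ≃ Fin N, (if C < (Xcnt S m f ω : ℝ) then (1 : ℝ) else 0) ≤
      (1 / C ^ k) * ((if InFirst m ω {f} then (1 : ℝ) else 0) * (Xcnt S m f ω : ℝ) ^ k) := by
    intro ω
    split_ifs with h1 h2
    · rw [one_mul, one_div, inv_mul_eq_div, one_le_div (by positivity)]
      exact pow_le_pow_left₀ hC.le h1.le k
    · exfalso
      have hX : 0 < Xcnt S m f ω := by
        have : (0 : ℝ) < Xcnt S m f ω := hC.trans h1
        exact_mod_cast this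
      unfold Xcnt at hX
      obtain ⟨i, hi⟩ := Finset.card_pos.mp hX
      simp only [Finset.mem_filter, Finset.mem_univ, true_and] at hi
      apply h2
      intro e he
      rw [Finset.mem_singleton] at he
      subst he
      exact hi.2 _ hi.1
    · positivity
    · simp
  refine (Finset.expect_le_expect (fun ω _ => h1 ω)).trans ?_
  rw [← Finset.mul_expect]
  refine (mul_le_mul_of_nonneg_left hmb (by positivity)).trans (le_of_eq ?_)
  rw [Finset.card_singleton, pow_one, div_pow]
  field_simp

end Moments

section Trunc
open BigOperators
open scoped Classical
set_option linter.unusedSectionVars false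

variable {α : Type*} [Fintype α] {N : ℕ} {ι : Type*} [Fintype ι]

def LastOf (ω : α ≃ Fin N) (A : Finset α) (e : α) : Prop := e ∈ A ∧ ∀ f ∈ A, ω f ≤ ω e

/-- number of elements among the first `m` that are last in some member of the family -/
noncomputable def Zcnt (S : ι → Finset α) (m : ℕ) (ω : α ≃ Fin N) : ℕ :=
  (Finset.univ.filter fun e => (ω e : ℕ) < m ∧ ∃ i, LastOf ω (S i) e).card

def ValidFam (S : ι → Finset α) (m : ℕ) (C : ℝ) (ω : α ≃ Fin N) (T : Finset ι) : Prop :=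
  (∀ i ∈ T, InFirst m ω (S i)) ∧
  (∀ i ∈ T, ∀ j ∈ T, ∀ e, LastOf ω (S i) e → LastOf ω (S j) e → i = j) ∧
  ∀ f, ((T.filter (fun i => f ∈ S i)).card : ℝ) ≤ C

noncomputable def Ztr (S : ι → Finset α) (m : ℕ) (C : ℝ) (ω : α ≃ Fin N) : ℕ :=
  (Finset.univ.filter (ValidFam S m C ω)).sup Finset.card

lemma le_Ztr (S : ι → Finset α) (m : ℕ) (C : ℝ) (ω : α ≃ Fin N) (T : Finset ι)
    (h : ValidFam S m C ω T) : T.card ≤ Ztr S m C ω :=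
  Finset.le_sup (f := Finset.card) (by simpa using h)

lemma exists_Ztr (S : ι → Finset α) (m : ℕ) (C : ℝ) (hC : 0 ≤ C) (ω : α ≃ Fin N) :
    ∃ T, ValidFam S m C ω T ∧ Ztr S m C ω = T.card := by
  have hne : (Finset.univ.filter (ValidFam S m C ω)).Nonempty :=
    ⟨∅, by simp [ValidFam, hC]⟩
  obtain ⟨T, hT, h⟩ := Finset.exists_mem_eq_sup _ hne Finset.card
  exact ⟨T, by simpa using hT, h⟩

lemma Ztr_le_swap (S : ι → Finset α) (m : ℕ) (C : ℝ) (hC : 0 ≤ C) (ω : α ≃ Fin N) (a b : α) :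
    (Ztr S m C ω : ℝ) ≤ Ztr S m C ((Equiv.swap a b).trans ω) + 2 * C := by
  obtain ⟨T, hT, h⟩ := exists_Ztr S m C hC ω
  set T' := T.filter (fun i => a ∉ S i ∧ b ∉ S i) with hT'
  have hsw : ∀ i ∈ T', ∀ e ∈ S i, ((Equiv.swap a b).trans ω) e = ω e := by
    intro i hi e he
    simp only [hT', Finset.mem_filter] at hi
    rw [Equiv.trans_apply, Equiv.swap_apply_of_ne_of_ne]
    · rintro rfl; exact hi.2.1 he
    · rintro rfl; exact hi.2.2 he
  have hlast : ∀ i ∈ T', ∀ e, LastOf ((Equiv.swap a b).trans ω) (S i) e → LastOf ω (S i) e := by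
    rintro i hi e ⟨he, hf⟩
    refine ⟨he, fun f hfS => ?_⟩
    have := hf f hfS
    rwa [hsw i hi f hfS, hsw i hi e he] at this
  have hsub : T' ⊆ T := Finset.filter_subset _ _
  have hv : ValidFam S m C ((Equiv.swap a b).trans ω) T' := by
    refine ⟨?_, ?_, ?_⟩
    · intro i hi e he
      rw [hsw i hi e he]
      exact hT.1 i (hsub hi) e he
    · intro i hi j hj e h1 h2
      exact hT.2.1 i (hsub hi) j (hsub hj) e (hlast i hi e h1) (hlast j hj e h2)
    · intro f
      refine le_trans ?_ (hT.2.2 f)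
      exact_mod_cast Finset.card_le_card (Finset.filter_subset_filter _ hsub)
  have h1 := le_Ztr S m C _ T' hv
  have h2 : T ⊆ T' ∪ (T.filter (fun i => a ∈ S i) ∪ T.filter (fun i => b ∈ S i)) := by
    intro i hi
    simp only [hT', Finset.mem_union, Finset.mem_filter]
    tauto
  have h3 : T.card ≤ T'.card + ((T.filter (fun i => a ∈ S i)).card +
      (T.filter (fun i => b ∈ S i)).card) :=
    (Finset.card_le_card h2).trans ((Finset.card_union_le _ _).trans
      (Nat.add_le_add_left (Finset.card_union_le _ _) _))
  have h3' : (T.card : ℝ) ≤ T'.card + ((T.filter (fun i => a ∈ S i)).card +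
      (T.filter (fun i => b ∈ S i)).card) := by exact_mod_cast h3
  have h1' : (T'.card : ℝ) ≤ Ztr S m C ((Equiv.swap a b).trans ω) := by exact_mod_cast h1
  rw [h]
  linarith [hT.2.2 a, hT.2.2 b]

lemma Ztr_lip (S : ι → Finset α) (m : ℕ) (C : ℝ) (hC : 0 ≤ C) :
    LipSwap (2 * C) (fun ω : α ≃ Fin N => (Ztr S m C ω : ℝ)) := by
  intro a b ω
  have h1 := Ztr_le_swap S m C hC ω a b
  have h2 := Ztr_le_swap S m C hC ((Equiv.swap a b).trans ω) a b
  have : (Equiv.swap a b).trans ((Equiv.swap a b).trans ω) = ω := by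
    ext x; simp
  rw [this] at h2
  rw [abs_le]
  constructor <;> linarith

lemma first_congr {i : ℕ} {ω ω' : α ≃ Fin N}
    (h : ∀ j : Fin N, (j : ℕ) < i → ω.symm j = ω'.symm j) (e : α) (he : (ω e : ℕ) < i) :
    ω' e = ω e := by
  have := h (ω e) he
  rw [Equiv.symm_apply_apply] at this
  conv_lhs => rw [this]
  simp

lemma Ztr_dep (S : ι → Finset α) (m : ℕ) (C : ℝ) :
    DepFirst (min m N) (fun ω : α ≃ Fin N => (Ztr S m C ω : ℝ)) := by
  have key : ∀ ω ω' : α ≃ Fin N, (∀ j : Fin N, (j : ℕ) < min m N → ω.symm j = ω'.symm j) →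
      ∀ T, ValidFam S m C ω T → ValidFam S m C ω' T := by
    rintro ω ω' h T ⟨h1, h2, h3⟩
    have hc : ∀ i ∈ T, ∀ e ∈ S i, ω' e = ω e := by
      intro i hi e he
      exact first_congr h e (lt_min (h1 i hi e he) (ω e).2)
    have hl : ∀ i ∈ T, ∀ e, LastOf ω' (S i) e → LastOf ω (S i) e := by
      rintro i hi e ⟨he, hf⟩
      refine ⟨he, fun f hfS => ?_⟩
      have := hf f hfS
      rwa [hc i hi f hfS, hc i hi e he] at this
    refine ⟨?_, ?_, h3⟩
    · intro i hi e he
      rw [hc i hi e he]; exact h1 i hi e he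
    · intro i hi j hj e he he'
      exact h2 i hi j hj e (hl i hi e he) (hl j hj e he')
  intro ω ω' h
  have : ValidFam S m C ω = ValidFam S m C ω' := by
    funext T
    exact propext ⟨key ω ω' h T, key ω' ω (fun j hj => (h j hj).symm) T⟩
  simp only [Ztr, this]

lemma Zcnt_le (hN : Fintype.card α = N) (S : ι → Finset α) (m : ℕ) (ω : α ≃ Fin N) :
    Zcnt S m ω ≤ N :=
  (Finset.card_le_univ _).trans hN.le

lemma Ztr_le_Zcnt (S : ι → Finset α) (hS : ∀ i, (S i).Nonempty) (m : ℕ) (C : ℝ) (hC : 0 ≤ C)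
    (ω : α ≃ Fin N) : Ztr S m C ω ≤ Zcnt S m ω := by
  obtain ⟨T, hT, h⟩ := exists_Ztr S m C hC ω
  rw [h]
  have hex : ∀ i, ∃ e, LastOf ω (S i) e := by
    intro i
    obtain ⟨e, he, hm⟩ := Finset.exists_max_image (S i) ω (hS i)
    exact ⟨e, he, hm⟩
  choose l hl using hex
  apply Finset.card_le_card_of_injOn l
  · intro i hi
    simp only [Finset.coe_filter, Finset.mem_univ, true_and, Set.mem_ofPred_eq]
    exact ⟨hT.1 i hi _ (hl i).1, i, hl i⟩
  · intro i hi j hj hij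
    exact hT.2.1 i hi j hj (l i) (hl i) (by rw [hij]; exact hl j)

lemma Zcnt_le_Ztr (S : ι → Finset α) (m : ℕ) (C : ℝ)
    (ω : α ≃ Fin N) (hΓ : ∀ f, (Xcnt S m f ω : ℝ) ≤ C) : Zcnt S m ω ≤ Ztr S m C ω := by
  set W := (Finset.univ.filter fun e => (ω e : ℕ) < m ∧ ∃ i, LastOf ω (S i) e) with hW
  have hex : ∀ e : W, ∃ i, LastOf ω (S i) e := by
    rintro ⟨e, he⟩
    simp only [hW, Finset.mem_filter] at he
    exact he.2.2
  choose w hw using hex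
  have hinj : Function.Injective w := by
    intro e e' h
    have h1 := hw e
    have h2 := hw e'
    rw [← h] at h2
    exact Subtype.ext (ω.injective (le_antisymm (h2.2 _ h1.1) (h1.2 _ h2.1)))
  have hin : ∀ e : W, InFirst m ω (S (w e)) := by
    intro e f hf
    have h1 := (hw e).2 f hf
    have he := e.2
    simp only [hW, Finset.mem_filter] at he
    exact lt_of_le_of_lt h1 he.2.1
  have hv : ValidFam S m C ω (Finset.univ.image w) := by
    refine ⟨?_, ?_, ?_⟩
    · intro i hi
      simp only [Finset.mem_image, Finset.mem_univ, true_and] at hi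
      obtain ⟨e, rfl⟩ := hi
      exact hin e
    · intro i hi j hj x hx hx'
      simp only [Finset.mem_image, Finset.mem_univ, true_and] at hi hj
      obtain ⟨e, rfl⟩ := hi
      obtain ⟨e', rfl⟩ := hj
      have h1 := hw e
      have h2 := hw e'
      have e1 : (e : α) = x := ω.injective (le_antisymm (hx.2 _ h1.1) (h1.2 _ hx.1))
      have e2 : (e' : α) = x := ω.injective (le_antisymm (hx'.2 _ h2.1) (h2.2 _ hx'.1))
      congr 1
      exact Subtype.ext (e1.trans e2.symm)
    · intro f
      refine le_trans ?_ (hΓ f)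
      unfold Xcnt
      have : ((Finset.univ.image w).filter (fun i => f ∈ S i)) ⊆
          (Finset.univ.filter fun i => f ∈ S i ∧ InFirst m ω (S i)) := by
        intro i hi
        simp only [Finset.mem_filter, Finset.mem_image, Finset.mem_univ, true_and] at hi ⊢
        obtain ⟨⟨e, rfl⟩, hf⟩ := hi
        exact ⟨hf, hin e⟩
      exact_mod_cast Finset.card_le_card this
  have := le_Ztr S m C ω _ hv
  rw [Finset.card_image_of_injective _ hinj, Finset.card_univ, Fintype.card_coe] at this
  exact this

theorem abstract_conc (hN : Fintype.card α = N) (hN0 : 0 < N) (S : ι → Finset α) (r : ℕ)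
    (hr : 0 < r)
    (hS : ∀ i, (S i).card = r) (m : ℕ) (hm : 0 < m) (D : ℝ) (hD : 0 ≤ D)
    (hdeg : ∀ J : Finset α, J.Nonempty → J.card ≤ r →
      ((Finset.univ.filter fun i => J ⊆ S i).card : ℝ) * ((m : ℝ) / N) ^ (r - J.card) ≤ D)
    (k : ℕ) (hk : 0 < k) (C : ℝ) (hC : 0 < C) (s : ℝ) (hs : 0 < s)
    (hδ : N * (m * (((k * r + 2 : ℝ) ^ r * D) / C) ^ k) ≤ s) :
    𝔼 ω : α ≃ Fin N, (if 2 * s ≤ |(Zcnt S m ω : ℝ) - 𝔼 ω' : α ≃ Fin N, (Zcnt S m ω' : ℝ)|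
        then (1 : ℝ) else 0) ≤
      2 * Real.exp (- (s ^ 2 / (2 * m * (2 * (2 * C)) ^ 2))) +
        m * (((k * r + 2 : ℝ) ^ r * D) / C) ^ k := by
  set δ := m * (((k * r + 2 : ℝ) ^ r * D) / C) ^ k with hδdef
  have hN' : (0 : ℝ) < N := by exact_mod_cast hN0
  have hSne : ∀ i, (S i).Nonempty := fun i => Finset.card_pos.mp (by rw [hS i]; exact hr)
  -- bad event
  let bad : (α ≃ Fin N) → ℝ := fun ω => if ∃ f, C < (Xcnt S m f ω : ℝ) then 1 else 0
  have hbad : 𝔼 ω, bad ω ≤ δ := by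
    have h1 : ∀ ω, bad ω ≤ ∑ f : α, (if C < (Xcnt S m f ω : ℝ) then (1 : ℝ) else 0) := by
      intro ω
      simp only [bad]
      split_ifs with h
      · obtain ⟨f, hf⟩ := h
        have := Finset.single_le_sum (f := fun f => (if C < (Xcnt S m f ω : ℝ) then (1 : ℝ) else 0))
          (fun f _ => by split_ifs <;> norm_num) (Finset.mem_univ f)
        simpa [hf] using this
      · exact Finset.sum_nonneg (fun f _ => by split_ifs <;> norm_num)
    refine (Finset.expect_le_expect (fun ω _ => h1 ω)).trans ?_
    rw [Finset.expect_sum_comm]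
    refine (Finset.sum_le_sum (fun f _ => tail_X hN S r hS m f D hD hdeg k hk C hC)).trans ?_
    rw [Finset.sum_const, Finset.card_univ, hN, nsmul_eq_mul, hδdef]
    apply le_of_eq
    field_simp
  -- comparison
  have hcmp : ∀ ω : α ≃ Fin N, |(Zcnt S m ω : ℝ) - Ztr S m C ω| ≤ N * bad ω := by
    intro ω
    have h1 : (Ztr S m C ω : ℝ) ≤ Zcnt S m ω := by
      exact_mod_cast Ztr_le_Zcnt S hSne m C hC.le ω
    rw [abs_of_nonneg (by linarith)]
    simp only [bad]
    split_ifs with h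
    · have h2 : (Zcnt S m ω : ℝ) ≤ N := by exact_mod_cast Zcnt_le hN S m ω
      have h3 : (0 : ℝ) ≤ Ztr S m C ω := Nat.cast_nonneg _
      linarith
    · push Not at h
      have h2 : (Zcnt S m ω : ℝ) ≤ Ztr S m C ω := by
        exact_mod_cast Zcnt_le_Ztr S m C ω h
      linarith
  have hmean : |𝔼 ω : α ≃ Fin N, (Zcnt S m ω : ℝ) - 𝔼 ω : α ≃ Fin N, (Ztr S m C ω : ℝ)| ≤ s := by
    rw [← Finset.expect_sub_distrib]
    refine (Finset.abs_expect_le _ _).trans ?_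
    refine (Finset.expect_le_expect (fun ω _ => hcmp ω)).trans ?_
    rw [← Finset.mul_expect]
    exact (mul_le_mul_of_nonneg_left hbad hN'.le).trans hδ
  have haz := azuma (α := α) (2 * C) (by positivity) (min m N) m (min_le_right _ _)
    (min_le_left _ _) hm (fun ω => (Ztr S m C ω : ℝ)) (Ztr_dep S m C) (Ztr_lip S m C hC.le) s hs
  set E1 := 𝔼 ω : α ≃ Fin N, (Zcnt S m ω : ℝ)
  set E2 := 𝔼 ω : α ≃ Fin N, (Ztr S m C ω : ℝ)
  have hfin : ∀ ω : α ≃ Fin N, (if 2 * s ≤ |(Zcnt S m ω : ℝ) - E1| then (1 : ℝ) else 0) ≤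
      (if s ≤ |(Ztr S m C ω : ℝ) - E2| then (1 : ℝ) else 0) + bad ω := by
    intro ω
    have hb0 : 0 ≤ bad ω := by simp only [bad]; split_ifs <;> norm_num
    by_cases h : 2 * s ≤ |(Zcnt S m ω : ℝ) - E1|
    · rw [if_pos h]
      by_cases hb : ∃ f, C < (Xcnt S m f ω : ℝ)
      · have : bad ω = 1 := by simp only [bad, if_pos hb]
        rw [this]
        split_ifs <;> norm_num
      · have hb1 : bad ω = 0 := by simp only [bad, if_neg hb]
        have h3 := hcmp ω
        rw [hb1, mul_zero] at h3
        have h4 : (Zcnt S m ω : ℝ) = Ztr S m C ω := by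
          have := abs_nonpos_iff.mp h3; linarith
        rw [if_pos, hb1]
        · norm_num
        · rw [h4] at h
          have := abs_sub_le (Ztr S m C ω : ℝ) E2 E1
          rw [abs_sub_comm E2 E1] at this
          linarith
    · rw [if_neg h]
      split_ifs <;> linarith
  refine (Finset.expect_le_expect (fun ω _ => hfin ω)).trans ?_
  rw [Finset.expect_add_distrib]
  exact add_le_add haz hbad

end Trunc

section GraphPart
open BigOperators
open scoped Classical
set_option linter.unusedSectionVars false

variable {β : Type*} [Fintype β]

/-- vertices covered by a set of edges -/
noncomputable def cov {γ : Type*} [Fintype γ] (G : Finset (Sym2 γ)) : Finset γ :=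
  Finset.univ.filter (fun x => ∃ e ∈ G, x ∈ e)

lemma mem_cov {γ : Type*} [Fintype γ] (G : Finset (Sym2 γ)) (x : γ) :
    x ∈ cov G ↔ ∃ e ∈ G, x ∈ e := by simp [cov]

lemma card_cov_le {γ : Type*} [Fintype γ] (G : Finset (Sym2 γ)) : (cov G).card ≤ 2 * G.card := by
  have h : cov G ⊆ G.biUnion (fun e => e.toFinset) := by
    intro x hx
    rw [mem_cov] at hx
    simpa using hx
  refine (Finset.card_le_card h).trans ?_
  rw [mul_comm]
  apply Finset.card_biUnion_le_card_mul
  intro e _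
  rw [Sym2.card_toFinset]
  split_ifs <;> norm_num

lemma two_le_cov (H : SimpleGraph β) (G : Finset (Sym2 β)) (hG : ∀ e ∈ G, e ∈ H.edgeSet)
    (h1 : 1 ≤ G.card) : 2 ≤ (cov G).card := by
  obtain ⟨e, he⟩ := Finset.card_pos.mp h1
  induction e with | _ a b
  have hab : a ≠ b := (H.mem_edgeSet.mp (hG _ he)).ne
  have : ({a, b} : Finset β) ⊆ cov G := by
    intro x hx
    simp only [Finset.mem_insert, Finset.mem_singleton] at hx
    rw [mem_cov]
    exact ⟨_, he, by simpa using hx⟩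
  have := Finset.card_le_card this
  rwa [Finset.card_pair hab] at this

lemma three_le_cov (H : SimpleGraph β) (G : Finset (Sym2 β)) (hG : ∀ e ∈ G, e ∈ H.edgeSet)
    (h1 : 2 ≤ G.card) : 3 ≤ (cov G).card := by
  by_contra hlt
  have hle : (cov G).card ≤ 2 := by omega
  obtain ⟨e, he⟩ := Finset.card_pos.mp (show 0 < G.card by omega)
  induction e with | _ a b
  have hab : a ≠ b := (H.mem_edgeSet.mp (hG _ he)).ne
  have hsub : ({a, b} : Finset β) ⊆ cov G := by
    intro x hx
    simp only [Finset.mem_insert, Finset.mem_singleton] at hx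
    rw [mem_cov]
    exact ⟨_, he, by simpa using hx⟩
  have heq : ({a, b} : Finset β) = cov G :=
    Finset.eq_of_subset_of_card_le hsub (by rw [Finset.card_pair hab]; exact hle)
  have : G.card ≤ 1 := by
    rw [Finset.card_le_one]
    have key : ∀ e ∈ G, e = s(a, b) := by
      intro e' he'
      induction e' with | _ c d
      have hcd : c ≠ d := (H.mem_edgeSet.mp (hG _ he')).ne
      have hc : c ∈ cov G := (mem_cov _ _).mpr ⟨_, he', by simp⟩
      have hd : d ∈ cov G := (mem_cov _ _).mpr ⟨_, he', by simp⟩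
      rw [← heq] at hc hd
      simp only [Finset.mem_insert, Finset.mem_singleton] at hc hd
      rw [Sym2.eq_iff]
      rcases hc with rfl | rfl <;> rcases hd with rfl | rfl <;> simp_all
    intro x hx y hy
    rw [key x hx, key y hy]
  omega

/-- subgraph spanned by a set of edges -/
def spanSub (H : SimpleGraph β) (G : Finset (Sym2 β)) (hG : ∀ e ∈ G, e ∈ H.edgeSet) :
    H.Subgraph where
  verts := (cov G : Set β)
  Adj a b := s(a, b) ∈ G
  adj_sub h := hG _ h
  edge_vert h := by
    rw [Finset.mem_coe, mem_cov]
    exact ⟨_, h, by simp⟩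
  symm := ⟨fun a b h => by rwa [Sym2.eq_swap]⟩

lemma spanSub_edgeSet (H : SimpleGraph β) (G : Finset (Sym2 β)) (hG : ∀ e ∈ G, e ∈ H.edgeSet) :
    (spanSub H G hG).edgeSet = (G : Set (Sym2 β)) := by
  ext e
  induction e with | _ a b
  rw [SimpleGraph.Subgraph.mem_edgeSet]
  rfl

lemma card_ge_three (H : SimpleGraph β) (h2 : 2 ≤ H.edgeSet.ncard) : 3 ≤ Fintype.card β := by
  have h := three_le_cov H H.edgeFinset (fun e he => by simpa using he)
    (by rw [← Set.ncard_coe_finset, SimpleGraph.coe_edgeFinset]; exact h2)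
  exact h.trans (Finset.card_le_univ _)

lemma d2_nonneg (H : SimpleGraph β) (h2 : 2 ≤ H.edgeSet.ncard) : 0 ≤ d2 H := by
  have h3 := card_ge_three H h2
  have h3' : (3 : ℝ) ≤ Fintype.card β := by exact_mod_cast h3
  have h2' : (2 : ℝ) ≤ H.edgeSet.ncard := by exact_mod_cast h2
  unfold d2
  apply div_nonneg <;> linarith

lemma d2_mul (H : SimpleGraph β) (h2 : 2 ≤ H.edgeSet.ncard) :
    d2 H * ((Fintype.card β : ℝ) - 2) = (H.edgeSet.ncard : ℝ) - 1 := by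
  have h3 := card_ge_three H h2
  have h3' : (3 : ℝ) ≤ Fintype.card β := by exact_mod_cast h3
  unfold d2
  rw [div_mul_cancel₀]
  linarith

lemma edge_le (H : SimpleGraph β) (hH : TwoBalanced H) (G : Finset (Sym2 β))
    (hG : ∀ e ∈ G, e ∈ H.edgeSet) (h1 : 1 ≤ G.card) :
    (G.card : ℝ) - 1 ≤ d2 H * (((cov G).card : ℝ) - 2) := by
  rcases Nat.lt_or_ge G.card 2 with hlt | hge
  · have : G.card = 1 := by omega
    rw [this]
    have h2 : (2 : ℝ) ≤ (cov G).card := by exact_mod_cast two_le_cov H G hG h1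
    have := d2_nonneg H hH.1
    norm_num
    apply mul_nonneg this; linarith
  · have h3 := three_le_cov H G hG hge
    have h3' : (3 : ℝ) ≤ (cov G).card := by exact_mod_cast h3
    have hv : (spanSub H G hG).verts.ncard = (cov G).card := Set.ncard_coe_finset _
    have he : (spanSub H G hG).edgeSet.ncard = G.card := by
      rw [spanSub_edgeSet, Set.ncard_coe_finset]
    by_cases htop : spanSub H G hG = ⊤
    · rw [htop] at hv he
      simp only [SimpleGraph.Subgraph.verts_top, Set.ncard_univ, Nat.card_eq_fintype_card,
        SimpleGraph.Subgraph.edgeSet_top] at hv he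
      rw [← hv, ← he, d2_mul H hH.1]
    · have := hH.2 _ htop (by rw [hv]; exact h3)
      rw [hv, he, div_le_iff₀ (by linarith)] at this
      exact this

lemma half_le_d2 (H : SimpleGraph β) (hH : TwoBalanced H) : 1 / 2 ≤ d2 H := by
  have hc : H.edgeFinset.card = H.edgeSet.ncard := by
    rw [← Set.ncard_coe_finset, SimpleGraph.coe_edgeFinset]
  have h := edge_le H hH H.edgeFinset (fun e he => by simpa using he) (by rw [hc]; linarith [hH.1])
  have h2 := card_cov_le H.edgeFinset
  rw [hc] at h h2
  have h2' : ((cov H.edgeFinset).card : ℝ) ≤ 2 * H.edgeSet.ncard := by exact_mod_cast h2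
  have h3 : (2 : ℝ) ≤ H.edgeSet.ncard := by exact_mod_cast hH.1
  have h0 := d2_nonneg H hH.1
  by_contra hlt
  push Not at hlt
  nlinarith

lemma m2_eq (H : SimpleGraph β) (hH : TwoBalanced H) : m2 H = d2 H := by
  have hub : ∀ x ∈ {x : ℝ | ∃ G : H.Subgraph, 1 ≤ G.edgeSet.ncard ∧
    x = if G.edgeSet.ncard = 1 then 1 / 2
        else ((G.edgeSet.ncard : ℝ) - 1) / ((G.verts.ncard : ℝ) - 2)}, x ≤ d2 H := by
    rintro x ⟨G, hG1, rfl⟩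
    split_ifs with h
    · exact half_le_d2 H hH
    · have hfin : G.edgeSet.Finite := Set.toFinite _
      have hc : hfin.toFinset.card = G.edgeSet.ncard := (Set.ncard_eq_toFinset_card _ hfin).symm
      have hsub : ∀ e ∈ hfin.toFinset, e ∈ H.edgeSet := by
        intro e he
        exact G.edgeSet_subset (by simpa using he)
      have h1 := edge_le H hH hfin.toFinset hsub (by omega)
      have h3 := three_le_cov H hfin.toFinset hsub (by omega)
      have hle : (cov hfin.toFinset).card ≤ G.verts.ncard := by
        rw [← Set.ncard_coe_finset]
        apply Set.ncard_le_ncard _ (Set.toFinite _)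
        intro x hx
        rw [Finset.mem_coe, mem_cov] at hx
        obtain ⟨e, he, hxe⟩ := hx
        exact G.mem_verts_of_mem_edge (by simpa using he) hxe
      have h3' : (3 : ℝ) ≤ (cov hfin.toFinset).card := by exact_mod_cast h3
      have hle' : ((cov hfin.toFinset).card : ℝ) ≤ G.verts.ncard := by exact_mod_cast hle
      rw [hc] at h1
      rw [div_le_iff₀ (by linarith)]
      have h0 := d2_nonneg H hH.1
      nlinarith
  apply le_antisymm
  · apply csSup_le _ hub
    refine ⟨_, ⊤, ?_, rfl⟩
    rw [SimpleGraph.Subgraph.edgeSet_top]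
    linarith [hH.1]
  · apply le_csSup ⟨_, hub⟩
    refine ⟨⊤, ?_, ?_⟩
    · rw [SimpleGraph.Subgraph.edgeSet_top]; linarith [hH.1]
    · rw [SimpleGraph.Subgraph.edgeSet_top, if_neg (by have := hH.1; omega)]
      simp [d2]

noncomputable def copySet (H : SimpleGraph β) (n : ℕ) (φ : β ↪ Fin n) : Finset (EdgeType n) :=
  Finset.univ.filter (fun e => ∃ a b, H.Adj a b ∧ e.1 = s(φ a, φ b))

lemma mem_copySet (H : SimpleGraph β) (n : ℕ) (φ : β ↪ Fin n) (e : EdgeType n) :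
    e ∈ copySet H n φ ↔ ∃ ε ∈ H.edgeSet, Sym2.map φ ε = e.1 := by
  simp only [copySet, Finset.mem_filter, Finset.mem_univ, true_and]
  constructor
  · rintro ⟨a, b, h, he⟩
    exact ⟨s(a, b), h, by rw [he]; rfl⟩
  · rintro ⟨ε, h, he⟩
    induction ε with | _ a b
    exact ⟨a, b, h, he.symm⟩

lemma map_not_diag (H : SimpleGraph β) (n : ℕ) (φ : β ↪ Fin n) (ε : Sym2 β) (hε : ε ∈ H.edgeSet) :
    ¬ (Sym2.map φ ε).IsDiag := by
  induction ε with | _ a b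
  have : a ≠ b := (H.mem_edgeSet.mp hε).ne
  simpa using this

lemma card_copySet (H : SimpleGraph β) (n : ℕ) (φ : β ↪ Fin n) :
    (copySet H n φ).card = H.edgeSet.ncard := by
  rw [← Set.ncard_image_of_injective H.edgeSet (Sym2.map.injective φ.injective),
    ← Set.ncard_coe_finset, ← Set.ncard_image_of_injective _ Subtype.val_injective]
  congr 1
  ext e
  simp only [Set.mem_image, Finset.mem_coe, mem_copySet]
  constructor
  · rintro ⟨x, ⟨ε, h, h'⟩, rfl⟩; exact ⟨ε, h, h'⟩
  · rintro ⟨ε, h, rfl⟩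
    exact ⟨⟨_, map_not_diag H n φ ε h⟩, ⟨ε, h, rfl⟩, rfl⟩

lemma copyAt_iff (H : SimpleGraph β) (n : ℕ) (ord : EdgeOrder n) (e : EdgeType n) :
    copyAt H {f | ∃ g : EdgeType n, f = g.1 ∧ ord g ≤ ord e} e.1 ↔
      ∃ φ : β ↪ Fin n, LastOf ord (copySet H n φ) e := by
  unfold copyAt LastOf
  apply exists_congr
  intro φ
  rw [and_comm]
  apply and_congr
  · simp [copySet]
  · constructor
    · intro h f hf
      simp only [copySet, Finset.mem_filter, Finset.mem_univ, true_and] at hf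
      obtain ⟨a, b, hab, hf⟩ := hf
      obtain ⟨g, hg, hle⟩ := h a b hab
      have : f = g := Subtype.ext (hf.trans hg)
      rw [this]; exact hle
    · intro h a b hab
      refine ⟨⟨s(φ a, φ b), map_not_diag H n φ s(a, b) hab⟩, rfl, ?_⟩
      apply h
      simp only [copySet, Finset.mem_filter, Finset.mem_univ, true_and]
      exact ⟨a, b, hab, rfl⟩

lemma kept_card (H : SimpleGraph β) (n m : ℕ) (ord : EdgeOrder n) :
    ((keptEdges H n m ord).ncard : ℝ) =
      ((Finset.univ.filter fun j : Fin (Fintype.card (EdgeType n)) => (j : ℕ) < m).card : ℝ) -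
        Zcnt (copySet H n) m ord := by
  have h1 : (keptEdges H n m ord).ncard = (Finset.univ.filter fun e : EdgeType n =>
      (ord e : ℕ) < m ∧ ¬ ∃ φ : β ↪ Fin n, LastOf ord (copySet H n φ) e).card := by
    rw [← Set.ncard_coe_finset, ← Set.ncard_image_of_injective _ Subtype.val_injective]
    congr 1
    ext e
    simp only [keptEdges, copyAt_iff, Set.mem_ofPred_eq, Set.mem_image, Finset.mem_coe,
      Finset.mem_filter, Finset.mem_univ, true_and]
    constructor
    · rintro ⟨x, rfl, h⟩; exact ⟨x, h, rfl⟩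
    · rintro ⟨x, h, rfl⟩; exact ⟨x, rfl, h⟩
  have h2 : (Finset.univ.filter fun j : Fin (Fintype.card (EdgeType n)) => (j : ℕ) < m).card =
      (Finset.univ.filter fun e : EdgeType n => (ord e : ℕ) < m).card := by
    symm
    apply Finset.card_bij (fun e _ => ord e)
    · intro e he; simpa using he
    · intro e _ e' _ h; exact ord.injective h
    · intro j hj; exact ⟨ord.symm j, by simpa using hj, by simp⟩
  have h3 : (Finset.univ.filter fun e : EdgeType n => (ord e : ℕ) < m).card =
      (keptEdges H n m ord).ncard + Zcnt (copySet H n) m ord := by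
    rw [h1, add_comm]
    unfold Zcnt
    rw [← Finset.filter_filter, ← Finset.filter_filter, Finset.card_filter_add_card_filter_not]
  rw [h2, h3]
  push_cast; ring

end GraphPart

section Final
open BigOperators
open scoped Classical
set_option linter.unusedSectionVars false

variable {β : Type*} [Fintype β]

lemma count_emb (H : SimpleGraph β) (n : ℕ) (J : Finset (EdgeType n)) :
    (Finset.univ.filter fun φ : β ↪ Fin n => J ⊆ copySet H n φ).card ≤
      ∑ G ∈ H.edgeFinset.powerset.filter (fun G => G.card = J.card),
        (2 * J.card) ^ (cov G).card * n ^ (Fintype.card β - (cov G).card) := by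
  set VJ : Finset (Fin n) := cov (J.image Subtype.val) with hVJ
  have hVJc : VJ.card ≤ 2 * J.card :=
    (card_cov_le _).trans (Nat.mul_le_mul_left _ Finset.card_image_le)
  have hsub : (Finset.univ.filter fun φ : β ↪ Fin n => J ⊆ copySet H n φ) ⊆
      (H.edgeFinset.powerset.filter (fun G => G.card = J.card)).biUnion
        (fun G => Finset.univ.filter fun φ : β ↪ Fin n => ∀ x ∈ cov G, φ x ∈ VJ) := by
    intro φ hφ
    simp only [Finset.mem_filter, Finset.mem_univ, true_and] at hφ
    simp only [Finset.mem_biUnion, Finset.mem_filter, Finset.mem_univ, true_and,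
      Finset.mem_powerset]
    refine ⟨H.edgeFinset.filter (fun ε => Sym2.map φ ε ∈ J.image Subtype.val),
      ⟨Finset.filter_subset _ _, ?_⟩, ?_⟩
    · rw [← Finset.card_image_of_injective _ (Sym2.map.injective φ.injective),
        ← Finset.card_image_of_injective J Subtype.val_injective]
      congr 1
      ext e
      simp only [Finset.mem_image, Finset.mem_filter, SimpleGraph.mem_edgeFinset]
      constructor
      · rintro ⟨ε, ⟨_, h⟩, rfl⟩; exact h
      · rintro ⟨x, hx, rfl⟩
        obtain ⟨ε, hε, h⟩ := (mem_copySet H n φ x).mp (hφ hx)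
        exact ⟨ε, ⟨hε, x, hx, h.symm⟩, h⟩
    · intro x hx
      rw [mem_cov] at hx
      obtain ⟨ε, hε, hxε⟩ := hx
      rw [hVJ, mem_cov]
      exact ⟨_, (Finset.mem_filter.mp hε).2, Sym2.mem_map.mpr ⟨x, hxε, rfl⟩⟩
  refine (Finset.card_le_card hsub).trans (Finset.card_biUnion_le.trans ?_)
  apply Finset.sum_le_sum
  intro G _
  have h1 : (Finset.univ.filter fun φ : β ↪ Fin n => ∀ x ∈ cov G, φ x ∈ VJ).card ≤
      (Fintype.piFinset (fun x : β => if x ∈ cov G then VJ else Finset.univ)).card := by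
    apply Finset.card_le_card_of_injOn (fun φ : β ↪ Fin n => (φ : β → Fin n))
    · intro φ hφ
      simp only [Finset.coe_filter, Finset.mem_univ, true_and, Set.mem_ofPred_eq] at hφ
      rw [Finset.mem_coe, Fintype.mem_piFinset]
      intro x
      split_ifs with h
      · exact hφ x h
      · simp
    · intro φ _ φ' _ h
      exact DFunLike.coe_injective h
  refine h1.trans ?_
  rw [Fintype.card_piFinset]
  have : ∀ x : β, (if x ∈ cov G then VJ else Finset.univ).card =
      if x ∈ cov G then VJ.card else n := by
    intro x; split_ifs <;> simp
  simp_rw [this]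
  rw [Finset.prod_ite, Finset.prod_const, Finset.prod_const]
  have e1 : (Finset.univ.filter fun x => x ∈ cov G) = cov G := by ext; simp
  have e2 : (Finset.univ.filter fun x => x ∉ cov G) = (cov G)ᶜ := by ext; simp
  rw [e1, e2, Finset.card_compl]
  exact Nat.mul_le_mul_right _ (Nat.pow_le_pow_left hVJc _)

lemma deg_bound (H : SimpleGraph β) (hH : TwoBalanced H) (n : ℕ) (hn : 1 ≤ n) (q Q : ℝ)
    (hq0 : 0 ≤ q) (hQ : 1 ≤ Q) (hq : q ≤ Q * (n : ℝ) ^ (-(1 / d2 H)))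
    (J : Finset (EdgeType n)) (hJ : J.Nonempty) (hJr : J.card ≤ H.edgeSet.ncard) :
    ((Finset.univ.filter fun φ : β ↪ Fin n => J ⊆ copySet H n φ).card : ℝ) *
        q ^ (H.edgeSet.ncard - J.card) ≤
      2 ^ H.edgeSet.ncard * ((2 * H.edgeSet.ncard : ℝ) ^ Fintype.card β *
        Q ^ (H.edgeSet.ncard - 1)) := by
  set r := H.edgeSet.ncard with hr
  set v := Fintype.card β with hv
  have hrc : H.edgeFinset.card = r := by
    rw [← Set.ncard_coe_finset, SimpleGraph.coe_edgeFinset]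
  have hJ1 : 1 ≤ J.card := Finset.card_pos.mpr hJ
  have hd : 1 / 2 ≤ d2 H := half_le_d2 H hH
  have hn' : (1 : ℝ) ≤ n := by exact_mod_cast hn
  have hn0 : (0 : ℝ) < n := by linarith
  have hr2 : 2 ≤ r := hH.1
  have h1 : ((Finset.univ.filter fun φ : β ↪ Fin n => J ⊆ copySet H n φ).card : ℝ) ≤
      ∑ G ∈ H.edgeFinset.powerset.filter (fun G => G.card = J.card),
        (2 * J.card : ℝ) ^ (cov G).card * (n : ℝ) ^ (v - (cov G).card) := by
    exact_mod_cast count_emb H n J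
  refine (mul_le_mul_of_nonneg_right h1 (by positivity)).trans ?_
  rw [Finset.sum_mul]
  have h2 : ∀ G ∈ H.edgeFinset.powerset.filter (fun G => G.card = J.card),
      (2 * J.card : ℝ) ^ (cov G).card * (n : ℝ) ^ (v - (cov G).card) * q ^ (r - J.card) ≤
      (2 * r : ℝ) ^ v * Q ^ (r - 1) := by
    intro G hG
    simp only [Finset.mem_filter, Finset.mem_powerset] at hG
    have hGe : ∀ e ∈ G, e ∈ H.edgeSet := fun e he => by simpa using hG.1 he
    have hcv : (cov G).card ≤ v := Finset.card_le_univ _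
    have hJr' : (J.card : ℝ) ≤ r := by exact_mod_cast hJr
    have hJ1' : (1 : ℝ) ≤ J.card := by exact_mod_cast hJ1
    have a1 : (2 * J.card : ℝ) ^ (cov G).card ≤ (2 * r : ℝ) ^ v := by
      calc (2 * J.card : ℝ) ^ (cov G).card ≤ (2 * r : ℝ) ^ (cov G).card :=
            pow_le_pow_left₀ (by positivity) (by linarith) _
        _ ≤ _ := pow_le_pow_right₀ (by linarith) hcv
    have a2 : (n : ℝ) ^ (v - (cov G).card) * q ^ (r - J.card) ≤ Q ^ (r - 1) := by
      have b1 : q ^ (r - J.card) ≤ Q ^ (r - J.card) * ((n : ℝ) ^ (-(1 / d2 H))) ^ (r - J.card) := by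
        rw [← mul_pow]; exact pow_le_pow_left₀ hq0 hq _
      have b2 : (n : ℝ) ^ (v - (cov G).card) * ((n : ℝ) ^ (-(1 / d2 H))) ^ (r - J.card) ≤ 1 := by
        rw [← Real.rpow_natCast, ← Real.rpow_mul_natCast hn0.le, ← Real.rpow_add hn0]
        apply Real.rpow_le_one_of_one_le_of_nonpos hn'
        rw [Nat.cast_sub hcv, Nat.cast_sub hJr]
        have c1 := edge_le H hH G hGe (by omega)
        have c2 := d2_mul H hH.1
        rw [hG.2] at c1
        have hd0 : 0 < d2 H := by linarith
        have : d2 H * ((v : ℝ) - (cov G).card) ≤ r - J.card := by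
          rw [← hr, ← hv] at c2
          linarith
        have c3 : (v : ℝ) - (cov G).card ≤ (1 / d2 H) * (r - J.card) := by
          rw [one_div, inv_mul_eq_div, le_div_iff₀ hd0]
          linarith
        linarith
      calc (n : ℝ) ^ (v - (cov G).card) * q ^ (r - J.card)
          ≤ (n : ℝ) ^ (v - (cov G).card) * (Q ^ (r - J.card) * ((n : ℝ) ^ (-(1 / d2 H))) ^ (r - J.card)) :=
            mul_le_mul_of_nonneg_left b1 (by positivity)
        _ = Q ^ (r - J.card) * ((n : ℝ) ^ (v - (cov G).card) * ((n : ℝ) ^ (-(1 / d2 H))) ^ (r - J.card)) := by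
            ring
        _ ≤ Q ^ (r - J.card) * 1 := mul_le_mul_of_nonneg_left b2 (by positivity)
        _ = Q ^ (r - J.card) := mul_one _
        _ ≤ Q ^ (r - 1) := pow_le_pow_right₀ hQ (by omega)
    rw [mul_assoc]
    exact mul_le_mul a1 a2 (by positivity) (by positivity)
  refine (Finset.sum_le_sum h2).trans ?_
  rw [Finset.sum_const, nsmul_eq_mul]
  apply mul_le_mul_of_nonneg_right _ (by positivity)
  have h3 : (H.edgeFinset.powerset.filter (fun G => G.card = J.card)).card ≤ 2 ^ r := by
    rw [← hrc, ← Finset.card_powerset]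
    exact Finset.card_le_card (Finset.filter_subset _ _)
  exact_mod_cast h3

lemma prOf_eq (n : ℕ) (P : EdgeOrder n → Prop) :
    prOf (ordPMF n) {ord | P ord} =
      ENNReal.ofReal (𝔼 ω : EdgeOrder n, if P ω then (1 : ℝ) else 0) := by
  have hne : Nonempty (EdgeOrder n) := ⟨Fintype.equivFin _⟩
  have hpos : (0 : ℝ) < Fintype.card (EdgeOrder n) := by exact_mod_cast Fintype.card_pos
  unfold prOf
  rw [tsum_subtype {ord | P ord} (fun x => (ordPMF n) x), tsum_fintype]
  have : ∀ x : EdgeOrder n, Set.indicator {ord | P ord} (fun x => (ordPMF n) x) x =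
      ENNReal.ofReal (if P x then (Fintype.card (EdgeOrder n) : ℝ)⁻¹ else 0) := by
    intro x
    by_cases h : P x
    · rw [Set.indicator_of_mem (by exact h), if_pos h, ordPMF, PMF.uniformOfFintype_apply,
        ENNReal.ofReal_inv_of_pos hpos, ENNReal.ofReal_natCast]
    · rw [Set.indicator_of_notMem (by exact h), if_neg h, ENNReal.ofReal_zero]
  simp_rw [this]
  rw [← ENNReal.ofReal_sum_of_nonneg (fun x _ => by split_ifs <;> positivity)]
  congr 1
  rw [Fintype.expect_eq_sum_div_card, Finset.sum_div]
  apply Finset.sum_congr rfl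
  intro x _
  split_ifs <;> simp

lemma expKept_eq (H : SimpleGraph β) (n m : ℕ) :
    expKept H n m = 𝔼 ω : EdgeOrder n, ((keptEdges H n m ω).ncard : ℝ) := by
  have hne : Nonempty (EdgeOrder n) := ⟨Fintype.equivFin _⟩
  unfold expKept
  rw [tsum_fintype, Fintype.expect_eq_sum_div_card, Finset.sum_div]
  apply Finset.sum_congr rfl
  intro x _
  rw [ordPMF, PMF.uniformOfFintype_apply, ENNReal.toReal_inv, ENNReal.toReal_natCast,
    inv_mul_eq_div]

lemma card_edgeType (n : ℕ) : Fintype.card (EdgeType n) = n.choose 2 := by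
  rw [Sym2.card_subtype_not_diag, Fintype.card_fin]

/-- `abstract_conc` with arbitrary instances -/
theorem abstract_conc' {α : Type*} [Fintype α] {N : ℕ} {ι : Type*} [Fintype ι]
    [inst1 : Fintype (α ≃ Fin N)]
    (hN : Fintype.card α = N) (hN0 : 0 < N) (S : ι → Finset α) (r : ℕ)
    [inst2 : ∀ J : Finset α, DecidablePred fun i => J ⊆ S i]
    (hr : 0 < r)
    (hS : ∀ i, (S i).card = r) (m : ℕ) (hm : 0 < m) (D : ℝ) (hD : 0 ≤ D)
    (hdeg : ∀ J : Finset α, J.Nonempty → J.card ≤ r →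
      ((Finset.univ.filter fun i => J ⊆ S i).card : ℝ) * ((m : ℝ) / N) ^ (r - J.card) ≤ D)
    (k : ℕ) (hk : 0 < k) (C : ℝ) (hC : 0 < C) (s : ℝ) (hs : 0 < s)
    (hδ : N * (m * (((k * r + 2 : ℝ) ^ r * D) / C) ^ k) ≤ s)
    (g : (α ≃ Fin N) → ℝ) (a : ℝ) (hg : ∀ ω, g ω = a - Zcnt S m ω) :
    𝔼 ω : α ≃ Fin N, (if 2 * s ≤ |g ω - 𝔼 ω' : α ≃ Fin N, g ω'|
        then (1 : ℝ) else 0) ≤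
      2 * Real.exp (- (s ^ 2 / (2 * m * (2 * (2 * C)) ^ 2))) +
        m * (((k * r + 2 : ℝ) ^ r * D) / C) ^ k := by
  have e1 : inst1 = Equiv.instFintype := Subsingleton.elim _ _
  subst e1
  have hne : Nonempty (α ≃ Fin N) := ⟨Fintype.equivFinOfCardEq hN⟩
  have key := abstract_conc hN hN0 S r hr hS m hm D hD
    (fun J h1 h2 => by
      have := hdeg J h1 h2
      convert this) k hk C hC s hs hδ
  refine le_trans (le_of_eq ?_) key
  have hE : 𝔼 ω' : α ≃ Fin N, g ω' = a - 𝔼 ω' : α ≃ Fin N, (Zcnt S m ω' : ℝ) := by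
    simp_rw [hg]
    rw [Finset.expect_sub_distrib, Finset.expect_const Finset.univ_nonempty]
  rw [hE]
  apply Finset.expect_congr rfl
  intro ω _
  rw [hg, sub_sub_sub_cancel_left, abs_sub_comm]

/-- non-asymptotic form -/
lemma main_bound (H : SimpleGraph β) (hH : TwoBalanced H) (n m : ℕ) (hn : 2 ≤ n) (hm : 0 < m)
    (Q : ℝ) (hQ : 1 ≤ Q)
    (hq : (m : ℝ) / (n.choose 2 : ℕ) ≤ Q * (n : ℝ) ^ (-(1 / d2 H)))
    (k : ℕ) (hk : 0 < k) (C s : ℝ) (hC : 0 < C) (hs : 0 < s) (η : ℝ)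
    (hη : (((k * H.edgeSet.ncard + 2 : ℝ) ^ H.edgeSet.ncard *
      (2 ^ H.edgeSet.ncard * ((2 * H.edgeSet.ncard : ℝ) ^ Fintype.card β *
        Q ^ (H.edgeSet.ncard - 1)))) / C) ^ k ≤ η)
    (hδ : (n.choose 2 : ℕ) * (m * η) ≤ s) :
    prOf (ordPMF n) {ord | 2 * s ≤ |((keptEdges H n m ord).ncard : ℝ) - expKept H n m|} ≤
      ENNReal.ofReal (2 * Real.exp (- (s ^ 2 / (2 * m * (2 * (2 * C)) ^ 2))) + m * η) := by
  rw [prOf_eq]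
  apply ENNReal.ofReal_le_ofReal
  have hne : Nonempty (EdgeOrder n) := ⟨Fintype.equivFin _⟩
  have hN0 : 0 < Fintype.card (EdgeType n) := by
    rw [card_edgeType]; exact Nat.choose_pos hn
  have hD : (0 : ℝ) ≤ 2 ^ H.edgeSet.ncard * ((2 * H.edgeSet.ncard : ℝ) ^ Fintype.card β *
        Q ^ (H.edgeSet.ncard - 1)) := by positivity
  have hm' : (0 : ℝ) < m := by exact_mod_cast hm
  have hmη := mul_le_mul_of_nonneg_left hη hm'.le
  rw [expKept_eq]
  have hδ' : (Fintype.card (EdgeType n) : ℝ) * (m * (((k * H.edgeSet.ncard + 2 : ℝ) ^ H.edgeSet.ncard *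
      (2 ^ H.edgeSet.ncard * ((2 * H.edgeSet.ncard : ℝ) ^ Fintype.card β *
        Q ^ (H.edgeSet.ncard - 1)))) / C) ^ k) ≤ s := by
    rw [card_edgeType]
    exact (mul_le_mul_of_nonneg_left hmη (Nat.cast_nonneg _)).trans hδ
  have hq' : (m : ℝ) / (Fintype.card (EdgeType n) : ℝ) ≤ Q * (n : ℝ) ^ (-(1 / d2 H)) := by
    rw [card_edgeType]; exact hq
  have hr0 : 0 < H.edgeSet.ncard := lt_of_lt_of_le two_pos hH.1
  have hq0 : 0 ≤ (m : ℝ) / (Fintype.card (EdgeType n) : ℝ) := by positivity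
  have hdeg := deg_bound H hH n (le_trans one_le_two hn) _ Q hq0 hQ hq'
  have key := abstract_conc' (α := EdgeType n) rfl hN0 (copySet H n) H.edgeSet.ncard
    hr0 (card_copySet H n) m hm _ hD hdeg k hk C hC s hs hδ'
    (fun ω => ((keptEdges H n m ω).ncard : ℝ)) _ (kept_card H n m)
  refine le_trans key ?_
  exact add_le_add_right hmη _

end Final

section Asymp

lemma Bbound (c L k : ℝ) (r v : ℕ) (hr : 2 ≤ r) (hc : 0 < c) (hL : 1 ≤ L) (hk0 : 0 ≤ k)
    (hk : k ≤ (c + 11) * L) :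
    ((k * r + 2) ^ r * (2 ^ r * ((2 * r : ℝ) ^ v * (8 * L ^ 2) ^ (r - 1)))) ≤
      (((c + 11) * r + 2) ^ r * (2 ^ r * ((2 * r : ℝ) ^ v * 8 ^ (r - 1)))) * L ^ (3 * r - 2) := by
  have h1 : k * r + 2 ≤ ((c + 11) * r + 2) * L := by
    have : k * r ≤ (c + 11) * L * r := mul_le_mul_of_nonneg_right hk (Nat.cast_nonneg _)
    nlinarith
  have h2 : (k * r + 2) ^ r ≤ (((c + 11) * r + 2) * L) ^ r :=
    pow_le_pow_left₀ (by positivity) h1 _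
  have h3 : L ^ (3 * r - 2) = L ^ r * (L ^ 2) ^ (r - 1) := by
    rw [← pow_mul, ← pow_add]; congr 1; omega
  calc _ ≤ (((c + 11) * r + 2) * L) ^ r * (2 ^ r * ((2 * r : ℝ) ^ v * (8 * L ^ 2) ^ (r - 1))) :=
        mul_le_mul_of_nonneg_right h2 (by positivity)
    _ = _ := by rw [h3, mul_pow, mul_pow 8]; ring

set_option maxHeartbeats 1000000 in
lemma numerics (c : ℝ) (hc : 0 < c) (r v : ℕ) (hr : 2 ≤ r) (d : ℝ) (hd : 1 / 2 ≤ d) (n m : ℕ)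
    (hn : 4 ≤ n) (hL : 1 ≤ Real.log n)
    (hLK : Real.exp 1 * (((c + 11) * r + 2) ^ r * (2 ^ r * ((2 * r : ℝ) ^ v * 8 ^ (r - 1))))
      ≤ Real.log n)
    (hLc : 128 * (c + 2) ≤ Real.log n)
    (hm : m = ⌈(n : ℝ) ^ (2 - 1 / d) * Real.log n ^ 2⌉₊) :
    ∃ (k : ℕ) (Q C s η : ℝ), 0 < m ∧ 1 ≤ Q ∧
      (m : ℝ) / (n.choose 2 : ℕ) ≤ Q * (n : ℝ) ^ (-(1 / d)) ∧ 0 < k ∧ 0 < C ∧ 0 < s ∧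
      (((k * r + 2 : ℝ) ^ r * (2 ^ r * ((2 * r : ℝ) ^ v * Q ^ (r - 1)))) / C) ^ k ≤ η ∧
      (n.choose 2 : ℕ) * (m * η) ≤ s ∧
      2 * s = Real.sqrt m * Real.log n ^ (3 * r) ∧
      2 * Real.exp (- (s ^ 2 / (2 * m * (2 * (2 * C)) ^ 2))) + m * η ≤ (n : ℝ) ^ (-c) := by
  set L := Real.log n with hLdef
  set K := (((c + 11) * r + 2) ^ r * (2 ^ r * ((2 * r : ℝ) ^ v * 8 ^ (r - 1)))) with hK
  have hn' : (4 : ℝ) ≤ n := by exact_mod_cast hn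
  have hn0 : (0 : ℝ) < n := by linarith
  have hL0 : 0 < L := by linarith
  have hd0 : 0 < d := by linarith
  have hexpL : Real.exp L = n := Real.exp_log hn0
  have hid : 1 / d ≤ 2 := by rw [div_le_iff₀ hd0]; linarith
  have hpow1 : (1 : ℝ) ≤ (n : ℝ) ^ (2 - 1 / d) :=
    Real.one_le_rpow (by linarith) (by linarith)
  have hL2 : 1 ≤ L ^ 2 := one_le_pow₀ hL
  have hbase : 1 ≤ (n : ℝ) ^ (2 - 1 / d) * L ^ 2 := one_le_mul_of_one_le_of_one_le hpow1 hL2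
  have hm1 : (1 : ℝ) ≤ m := by
    rw [hm]; exact hbase.trans (Nat.le_ceil _)
  have hm0 : 0 < m := by exact_mod_cast (by linarith : (0 : ℝ) < m)
  have hm2 : (m : ℝ) ≤ 2 * ((n : ℝ) ^ (2 - 1 / d) * L ^ 2) := by
    have := Nat.ceil_lt_add_one (a := (n : ℝ) ^ (2 - 1 / d) * L ^ 2) (by positivity)
    rw [← hm] at this
    linarith
  have hsplit : (n : ℝ) ^ (2 - 1 / d) = n ^ 2 * (n : ℝ) ^ (-(1 / d)) := by
    rw [sub_eq_add_neg, Real.rpow_add hn0]; norm_num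
  have hN : ((n.choose 2 : ℕ) : ℝ) = n * (n - 1) / 2 := Nat.cast_choose_two ℝ n
  have hN4 : (n : ℝ) ^ 2 / 4 ≤ (n.choose 2 : ℕ) := by rw [hN]; nlinarith
  have hN1 : ((n.choose 2 : ℕ) : ℝ) ≤ (n : ℝ) ^ 2 := by rw [hN]; nlinarith
  have hNpos : (0 : ℝ) < (n.choose 2 : ℕ) := by nlinarith
  have hLn : L ≤ n := (Real.log_le_sub_one_of_pos hn0).trans (by linarith)
  have hm3 : (m : ℝ) ≤ 2 * (n : ℝ) ^ 4 := by
    have h1 : (n : ℝ) ^ (2 - 1 / d) ≤ (n : ℝ) ^ 2 := by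
      rw [← Real.rpow_natCast]
      apply Real.rpow_le_rpow_of_exponent_le (by linarith)
      have : 0 < 1 / d := by positivity
      push_cast; linarith
    have h2 : L ^ 2 ≤ (n : ℝ) ^ 2 := pow_le_pow_left₀ hL0.le hLn 2
    calc (m : ℝ) ≤ _ := hm2
      _ ≤ 2 * ((n : ℝ) ^ 2 * (n : ℝ) ^ 2) := by gcongr
      _ = _ := by ring
  set η := Real.exp (-((c + 10) * L)) with hη
  have hηn : (n : ℝ) ^ 10 * η = (n : ℝ) ^ (-c) := by
    rw [Real.rpow_def_of_pos hn0, ← hLdef, hη, ← hexpL, ← Real.exp_nat_mul, ← Real.exp_add]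
    congr 1; push_cast; ring
  have hη0 : 0 < η := Real.exp_pos _
  have hcle : (n : ℝ) ^ (-c) ≤ 1 := Real.rpow_le_one_of_one_le_of_nonpos (by linarith) (by linarith)
  have hc0 : 0 < (n : ℝ) ^ (-c) := Real.rpow_pos_of_pos hn0 _
  have hmη : (n : ℝ) ^ 2 * (m * η) ≤ (n : ℝ) ^ (-c) / 2 := by
    have h1 : (n : ℝ) ^ 2 * (m * η) ≤ (n : ℝ) ^ 2 * (2 * (n : ℝ) ^ 4 * η) := by gcongr
    have h2 : (4 : ℝ) ≤ (n : ℝ) ^ 4 := by nlinarith [sq_nonneg ((n : ℝ) ^ 2 - 1), sq_nonneg ((n:ℝ))]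
    have h3 : 4 * ((n : ℝ) ^ 6 * η) ≤ (n : ℝ) ^ 4 * ((n : ℝ) ^ 6 * η) :=
      mul_le_mul_of_nonneg_right h2 (by positivity)
    have h4 : (n : ℝ) ^ 4 * ((n : ℝ) ^ 6 * η) = (n : ℝ) ^ (-c) := by rw [← hηn]; ring
    have h5 : (n : ℝ) ^ 2 * (2 * (n : ℝ) ^ 4 * η) = 2 * ((n : ℝ) ^ 6 * η) := by ring
    linarith
  have hmη0 : 0 < m * η := by positivity
  have hsqm : 1 ≤ Real.sqrt m := Real.one_le_sqrt.mpr hm1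
  have hLr : 1 ≤ L ^ (3 * r) := one_le_pow₀ hL
  have hs1 : 1 ≤ Real.sqrt m * L ^ (3 * r) := one_le_mul_of_one_le_of_one_le hsqm hLr
  have hkpos : 0 < (c + 10) * L := by positivity
  refine ⟨⌈(c + 10) * L⌉₊, 8 * L ^ 2, L ^ (3 * r - 1), Real.sqrt m * L ^ (3 * r) / 2, η,
    hm0, by linarith, ?_, Nat.ceil_pos.mpr hkpos, by positivity, by linarith, ?_, ?_, by ring, ?_⟩
  · rw [div_le_iff₀ hNpos]
    rw [hsplit] at hm2
    have h0 : 0 ≤ 8 * L ^ 2 * (n : ℝ) ^ (-(1 / d)) := by positivity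
    have := mul_le_mul_of_nonneg_left hN4 h0
    refine hm2.trans (le_trans (le_of_eq ?_) this)
    ring
  · set k := ⌈(c + 10) * L⌉₊ with hk
    have hk1 : (k : ℝ) ≤ (c + 11) * L := by
      have := Nat.ceil_lt_add_one hkpos.le
      linarith
    have hk2 : (c + 10) * L ≤ k := Nat.le_ceil _
    have hB := Bbound c L k r v hr hc hL (Nat.cast_nonneg _) hk1
    rw [← hK] at hB
    have hX : ((k * r + 2 : ℝ) ^ r * (2 ^ r * ((2 * r : ℝ) ^ v * (8 * L ^ 2) ^ (r - 1)))) /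
        L ^ (3 * r - 1) ≤ Real.exp (-1) := by
      rw [div_le_iff₀ (by positivity)]
      refine hB.trans ?_
      have e : L ^ (3 * r - 1) = L * L ^ (3 * r - 2) := by
        rw [← pow_succ']; congr 1; omega
      rw [e, ← mul_assoc]
      apply mul_le_mul_of_nonneg_right _ (by positivity)
      rw [Real.exp_neg, inv_mul_eq_div, le_div_iff₀ (Real.exp_pos _)]
      linarith
    refine (pow_le_pow_left₀ (by positivity) hX k).trans ?_
    rw [← Real.exp_nat_mul, hη]
    apply Real.exp_le_exp.mpr
    linarith
  · have := mul_le_mul_of_nonneg_right hN1 hmη0.le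
    linarith
  · have h1 : (Real.sqrt m * L ^ (3 * r) / 2) ^ 2 / (2 * m * (2 * (2 * L ^ (3 * r - 1))) ^ 2) =
        L ^ 2 / 128 := by
      have e : L ^ (3 * r) = L * L ^ (3 * r - 1) := by
        rw [← pow_succ']; congr 1; omega
      rw [div_pow, mul_pow, Real.sq_sqrt (by positivity), e]
      have : L ^ (3 * r - 1) ≠ 0 := by positivity
      have : (m : ℝ) ≠ 0 := by positivity
      field_simp
      norm_num
    rw [h1]
    have h2 : m * η ≤ (n : ℝ) ^ (-c) / 2 :=
      (le_mul_of_one_le_left hmη0.le (one_le_pow₀ (by linarith))).trans hmη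
    have h3 : 2 * Real.exp (-(L ^ 2 / 128)) ≤ (n : ℝ) ^ (-c) / 2 := by
      have a1 : Real.exp (-(L ^ 2 / 128)) ≤ Real.exp (-((c + 2) * L)) := by
        apply Real.exp_le_exp.mpr
        nlinarith
      have a2 : (n : ℝ) ^ 2 * Real.exp (-((c + 2) * L)) = (n : ℝ) ^ (-c) := by
        rw [Real.rpow_def_of_pos hn0, ← hLdef, ← hexpL, ← Real.exp_nat_mul, ← Real.exp_add]
        congr 1; push_cast; ring
      have a3 : 4 * Real.exp (-((c + 2) * L)) ≤ (n : ℝ) ^ 2 * Real.exp (-((c + 2) * L)) :=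
        mul_le_mul_of_nonneg_right (by nlinarith) (Real.exp_pos _).le
      linarith
    linarith

end Asymp

/-- **Concentration of the number of edges in the inverted process**
(Theorem 3.3 of Warnke). For a 2-balanced graph `H` and
`m = ⌈n^{2-1/m₂(H)} (log n)²⌉`, the number of edges of `G_{n,m}(H)` deviates from its
mean by at least `√m (log n)^{3 e_H}` with probability at most `n^{-c}`. -/
theorem inverted_process_concentration {β : Type*} [Fintype β] (H : SimpleGraph β)
    (hH : TwoBalanced H) :
    ∀ c : ℝ, 0 < c → ∃ n₀ : ℕ, ∀ n ≥ n₀,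
      prOf (ordPMF n)
        {ord | Real.sqrt (⌈(n : ℝ) ^ (2 - 1 / m2 H) * Real.log n ^ 2⌉₊ : ℕ) *
              Real.log n ^ (3 * H.edgeSet.ncard) ≤
            |((keptEdges H n (⌈(n : ℝ) ^ (2 - 1 / m2 H) * Real.log n ^ 2⌉₊) ord).ncard : ℝ) -
              expKept H n (⌈(n : ℝ) ^ (2 - 1 / m2 H) * Real.log n ^ 2⌉₊)|} ≤
        ENNReal.ofReal ((n : ℝ) ^ (-c)) := by

  intro c hc
  have hlog : Filter.Tendsto (fun n : ℕ => Real.log n) Filter.atTop Filter.atTop :=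
    Real.tendsto_log_atTop.comp tendsto_natCast_atTop_atTop
  have hev := ((Filter.eventually_ge_atTop 4).and ((hlog.eventually_ge_atTop 1).and
    ((hlog.eventually_ge_atTop (Real.exp 1 *
      (((c + 11) * H.edgeSet.ncard + 2) ^ H.edgeSet.ncard * (2 ^ H.edgeSet.ncard *
        ((2 * H.edgeSet.ncard : ℝ) ^ Fintype.card β * 8 ^ (H.edgeSet.ncard - 1)))))).and
      (hlog.eventually_ge_atTop (128 * (c + 2))))))
  obtain ⟨n₀, h₀⟩ := Filter.eventually_atTop.mp hev
  refine ⟨n₀, fun n hn => ?_⟩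
  obtain ⟨hn4, hL, hLK, hLc⟩ := h₀ n hn
  rw [m2_eq H hH]
  generalize hm : ⌈(n : ℝ) ^ (2 - 1 / d2 H) * Real.log n ^ 2⌉₊ = m
  obtain ⟨k, Q, C, s, η, hm0, hQ, hq, hk, hC, hs, hη, hδ, h2s, hfin⟩ :=
    numerics c hc H.edgeSet.ncard (Fintype.card β) hH.1 (d2 H) (half_le_d2 H hH) n m
      hn4 hL hLK hLc hm.symm
  rw [← h2s]
  exact (main_bound H hH n m (by omega) hm0 Q hQ hq k hk C s hC hs η hη hδ).trans
    (ENNReal.ofReal_le_ofReal hfin)
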